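/- arXiv:2303.14316 — 2 statements merged into one kernel-verified Lean document; each statement's English description precedes it below -/
import Mathlib

section
/- The strictly increasing sequence (a_n) of natural numbers that are sums of two squares does not have metric Poissonian pair correlation: it is not the case that for almost every α ∈ [0,1) and every s > 0, T(α,N,s) → s as N → ∞. -/
open Real MeasureTheory Filter Finset
open scoped Classical

/-- `n` is a sum of two squares. -/
def IsSumTwoSquares (n : ℕ) : Prop := ∃ x y : ℤ, (n : ℤ) = x ^ 2 + y ^ 2

/-- Indicator function of the sums of two squares. -/
noncomputable def b (n : ℕ) : ℕ := if IsSumTwoSquares n then 1 else 0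

/-- `a n` is the `n`-th (1-indexed) natural number that is a sum of two squares,
in strictly increasing order. -/
noncomputable def a (n : ℕ) : ℕ := Nat.nth IsSumTwoSquares (n - 1)

/-- Distance to the nearest integer. -/
noncomputable def nint (x : ℝ) : ℝ := |x - round x|

/-- `R N v` counts pairs `1 ≤ n < m ≤ N` with `a m - a n = v`. -/
noncomputable def R (N v : ℕ) : ℕ :=
  ((Finset.Icc 1 N ×ˢ Finset.Icc 1 N).filter
    (fun p => p.1 < p.2 ∧ a p.2 - a p.1 = v)).card

/-- The pair correlation function
`T(α,N,s) = (1/N) Σ_{v ≥ 1} R_N(v)·1[‖vα‖ ≤ s/N]`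
(the sum is finite since `R N v = 0` for `v > a N`). -/
noncomputable def T (α : ℝ) (N : ℕ) (s : ℝ) : ℝ :=
  (1 / N) * ∑ v ∈ Finset.Icc 1 (a N),
    (R N v : ℝ) * (if nint (v * α) ≤ s / N then 1 else 0)

/-- The Cauchy–Schwarz lower bound for the number of collisions of a map on a finite set. -/
lemma sq_card_le_card_image_mul_card_collisions {ι β : Type*} [DecidableEq β] (S : Finset ι) (f : ι → β) :
    S.card ^ 2 ≤ (S.image f).card * ((S ×ˢ S).filter (fun p => f p.1 = f p.2)).card := by
  have h1 : S.card = ∑ y ∈ S.image f, (S.filter (fun x => f x = y)).card :=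
    Finset.card_eq_sum_card_fiberwise (fun x hx => Finset.mem_image_of_mem f hx)
  have h2 : ((S ×ˢ S).filter (fun p => f p.1 = f p.2)).card
      = ∑ y ∈ S.image f, (S.filter (fun x => f x = y)).card ^ 2 := by
    rw [Finset.card_eq_sum_card_fiberwise (f := fun p : ι × ι => f p.1) (t := S.image f)]
    · refine Finset.sum_congr rfl fun y _ => ?_
      rw [sq, ← Finset.card_product]
      congr 1
      ext ⟨u, v⟩
      simp only [Finset.mem_filter, Finset.mem_product]
      grind
    · intro p hp
      simp only [Finset.coe_filter, Finset.mem_product, Set.mem_ofPred_eq] at hp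
      exact Finset.mem_image_of_mem f hp.1.1
  rw [h2, h1]
  exact sq_sum_le_card_mul_sum_sq

/-- Quadruples `(u, s, v, t)` with `u, s ≤ M`, `v, t ≤ 2M` and `u v = s t`. -/
noncomputable def equalProducts (M : ℕ) : Finset (ℕ × ℕ × ℕ × ℕ) :=
  (Finset.Icc 1 M ×ˢ Finset.Icc 1 M ×ˢ Finset.Icc 1 (2 * M) ×ˢ Finset.Icc 1 (2 * M)).filter
    (fun p => p.1 * p.2.2.1 = p.2.1 * p.2.2.2)

lemma equalProducts_subset_image (M : ℕ) :
    equalProducts M ⊆ (((Finset.Icc 1 M ×ˢ Finset.Icc 1 M).sigma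
      (fun p => Finset.Icc 1 (M / max p.1 p.2) ×ˢ Finset.Icc 1 (2 * M / max p.1 p.2)))).image
      (fun z : (_ : ℕ × ℕ) × ℕ × ℕ =>
        (z.2.1 * z.1.1, z.2.1 * z.1.2, z.1.2 * z.2.2, z.1.1 * z.2.2)) := by
  rintro ⟨u, s, v, t⟩ h
  simp only [equalProducts, Finset.mem_filter, Finset.mem_product, Finset.mem_Icc] at h
  obtain ⟨⟨⟨hu, hu'⟩, ⟨hs, hs'⟩, ⟨hv, hv'⟩, ht, ht'⟩, e⟩ := h
  obtain ⟨g, x, ⟨y, rfl⟩, ⟨h, rfl⟩, rfl⟩ := exists_dvd_and_dvd_of_dvd_mul (Dvd.intro _ e)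
  have hg : 0 < g := Nat.pos_of_ne_zero (by rintro rfl; simp at hu)
  have hx : 0 < x := Nat.pos_of_ne_zero (by rintro rfl; simp at hu)
  have hy : 0 < y := Nat.pos_of_ne_zero (by rintro rfl; simp at hs)
  have hh : 0 < h := Nat.pos_of_ne_zero (by rintro rfl; simp at ht)
  have hvv : v = y * h := by
    have : (g * x) * v = (g * x) * (y * h) := by rw [e]; ring
    exact Nat.eq_of_mul_eq_mul_left (Nat.mul_pos hg hx) this
  subst hvv
  simp only [Finset.mem_image, Finset.mem_sigma, Finset.mem_product, Finset.mem_Icc]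
  refine ⟨⟨(x, y), (g, h)⟩, ⟨⟨⟨hx, ?_⟩, hy, ?_⟩, ⟨hg, ?_⟩, hh, ?_⟩, rfl⟩
  · exact (Nat.le_mul_of_pos_left _ hg).trans hu'
  · exact (Nat.le_mul_of_pos_left _ hg).trans hs'
  · rw [Nat.le_div_iff_mul_le (lt_max_of_lt_left hx)]
    rcases max_cases x y with h' | h' <;> simp only [h'.1] <;> assumption
  · rw [Nat.le_div_iff_mul_le (lt_max_of_lt_left hx), mul_comm]
    rcases max_cases x y with h' | h' <;> simp only [h'.1] <;> assumption

lemma sum_Icc_inv_le_one_add_log (M : ℕ) :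
    ∑ x ∈ Finset.Icc 1 M, ((x : ℝ))⁻¹ ≤ 1 + Real.log M := by
  have := harmonic_le_one_add_log M
  simpa [harmonic_eq_sum_Icc, Rat.cast_sum, Rat.cast_inv, Rat.cast_natCast] using this

lemma card_equalProducts_le (M : ℕ) :
    ((equalProducts M).card : ℝ) ≤ 4 * (M : ℝ) ^ 2 * (1 + Real.log M) := by
  have h1 : (equalProducts M).card ≤ ∑ p ∈ Finset.Icc 1 M ×ˢ Finset.Icc 1 M,
      (M / max p.1 p.2) * (2 * M / max p.1 p.2) := by
    refine (Finset.card_le_card (equalProducts_subset_image M)).trans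
      (Finset.card_image_le.trans ?_)
    rw [Finset.card_sigma]
    simp
  have h2 : ∀ p ∈ Finset.Icc 1 M ×ˢ Finset.Icc 1 M,
      (((M / max p.1 p.2) * (2 * M / max p.1 p.2) : ℕ) : ℝ) ≤
      2 * (M : ℝ) ^ 2 * ((if p.2 ≤ p.1 then ((p.1 : ℝ) ^ 2)⁻¹ else 0)
        + (if p.1 ≤ p.2 then ((p.2 : ℝ) ^ 2)⁻¹ else 0)) := by
    rintro ⟨x, y⟩ hp
    simp only
    have key : ∀ m : ℕ, (((M / m) * (2 * M / m) : ℕ) : ℝ) ≤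
        2 * (M : ℝ) ^ 2 * ((m : ℝ) ^ 2)⁻¹ := by
      intro m
      push_cast
      have i1 : ((M / m : ℕ) : ℝ) ≤ M / m := Nat.cast_div_le
      have i2 : ((2 * M / m : ℕ) : ℝ) ≤ 2 * M / m := by
        exact_mod_cast (Nat.cast_div_le (α := ℝ) (m := 2 * M) (n := m))
      calc _ ≤ ((M : ℝ) / m) * (2 * M / m) := by gcongr
        _ = _ := by rw [div_mul_div_comm, div_eq_mul_inv]; ring
    refine (key _).trans ?_
    gcongr
    rcases le_total y x with h | h
    · rw [max_eq_left h, if_pos h]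
      have : (0 : ℝ) ≤ if x ≤ y then ((y : ℝ) ^ 2)⁻¹ else 0 := by split_ifs <;> positivity
      linarith
    · rw [max_eq_right h, if_pos h]
      have : (0 : ℝ) ≤ if y ≤ x then ((x : ℝ) ^ 2)⁻¹ else 0 := by split_ifs <;> positivity
      linarith
  have h3 : ∀ x ∈ Finset.Icc 1 M,
      ∑ y ∈ Finset.Icc 1 M, (if y ≤ x then ((x : ℝ) ^ 2)⁻¹ else 0) = (x : ℝ)⁻¹ := by
    intro x hx
    rw [Finset.mem_Icc] at hx
    rw [← Finset.sum_filter, Finset.sum_const]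
    have : (Finset.Icc 1 M).filter (fun y => y ≤ x) = Finset.Icc 1 x := by
      ext y; simp only [Finset.mem_filter, Finset.mem_Icc]; omega
    rw [this, Nat.card_Icc, nsmul_eq_mul, Nat.add_sub_cancel]
    have : (x : ℝ) ≠ 0 := by
      have : x ≠ 0 := by omega
      exact_mod_cast this
    field_simp
  calc ((equalProducts M).card : ℝ)
      ≤ ∑ p ∈ Finset.Icc 1 M ×ˢ Finset.Icc 1 M,
        (((M / max p.1 p.2) * (2 * M / max p.1 p.2) : ℕ) : ℝ) := by exact_mod_cast h1
    _ ≤ _ := Finset.sum_le_sum h2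
    _ = 2 * (M : ℝ) ^ 2 * (∑ x ∈ Finset.Icc 1 M, (x : ℝ)⁻¹ + ∑ x ∈ Finset.Icc 1 M, (x : ℝ)⁻¹) := by
      rw [← Finset.mul_sum, Finset.sum_add_distrib, Finset.sum_product, Finset.sum_product_right]
      rw [Finset.sum_congr rfl h3]
    _ ≤ 2 * (M : ℝ) ^ 2 * ((1 + Real.log M) + (1 + Real.log M)) := by
      have := sum_Icc_inv_le_one_add_log M
      gcongr
    _ = _ := by ring

/-- The set of values `x² + y²` with `1 ≤ x, y ≤ M`. -/
noncomputable def sumsOfSquares (M : ℕ) : Finset ℕ :=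
  (Finset.Icc 1 M ×ˢ Finset.Icc 1 M).image (fun p => p.1 ^ 2 + p.2 ^ 2)

lemma card_collisions_sumsOfSquares_le (M : ℕ) :
    ((((Finset.Icc 1 M ×ˢ Finset.Icc 1 M) ×ˢ (Finset.Icc 1 M ×ˢ Finset.Icc 1 M)).filter
      (fun p : (ℕ × ℕ) × (ℕ × ℕ) =>
        p.1.1 ^ 2 + p.1.2 ^ 2 = p.2.1 ^ 2 + p.2.2 ^ 2)).card) ≤
      M ^ 2 + 2 * (equalProducts M).card := by
  set K := (((Finset.Icc 1 M ×ˢ Finset.Icc 1 M) ×ˢ (Finset.Icc 1 M ×ˢ Finset.Icc 1 M)).filter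
      (fun p : (ℕ × ℕ) × (ℕ × ℕ) =>
        p.1.1 ^ 2 + p.1.2 ^ 2 = p.2.1 ^ 2 + p.2.2 ^ 2)) with hK
  have memK : ∀ x y z w, ((x, y), (z, w)) ∈ K ↔ (((1 ≤ x ∧ x ≤ M) ∧ 1 ≤ y ∧ y ≤ M) ∧
      (1 ≤ z ∧ z ≤ M) ∧ 1 ≤ w ∧ w ≤ M) ∧ x ^ 2 + y ^ 2 = z ^ 2 + w ^ 2 := by
    intro x y z w
    simp [hK]
  have memE : ∀ u s v t, (u, s, v, t) ∈ equalProducts M ↔ ((1 ≤ u ∧ u ≤ M) ∧ (1 ≤ s ∧ s ≤ M) ∧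
      (1 ≤ v ∧ v ≤ 2 * M) ∧ 1 ≤ t ∧ t ≤ 2 * M) ∧ u * v = s * t := by
    intro u s v t
    simp [equalProducts]
  have gt_side : ∀ x y z w : ℕ, z < x → x ^ 2 + y ^ 2 = z ^ 2 + w ^ 2 → y < w := by
    intro x y z w h e
    by_contra! h'
    nlinarith [Nat.pow_lt_pow_left h (two_ne_zero), Nat.pow_le_pow_left h' 2]
  have split : K = (K.filter (fun p => p.1.1 = p.2.1)) ∪
      ((K.filter (fun p => p.2.1 < p.1.1)) ∪ (K.filter (fun p => p.1.1 < p.2.1))) := by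
    ext p
    simp only [Finset.mem_union, Finset.mem_filter]
    have := lt_trichotomy p.1.1 p.2.1
    tauto
  have c1 : (K.filter (fun p => p.1.1 = p.2.1)).card ≤ M ^ 2 := by
    have : M ^ 2 = (Finset.Icc 1 M ×ˢ Finset.Icc 1 M).card := by simp [sq]
    rw [this]
    refine Finset.card_le_card_of_injOn (fun p => p.1) ?_ ?_
    · rintro ⟨⟨x, y⟩, z, w⟩ h
      simp only [Finset.coe_filter, memK, Set.mem_ofPred_eq] at h
      simp only [Finset.coe_product, Set.mem_prod, Finset.coe_Icc, Set.mem_Icc]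
      exact h.1.1.1
    · rintro ⟨⟨x, y⟩, z, w⟩ h ⟨⟨x', y'⟩, z', w'⟩ h' e
      simp only [Finset.coe_filter, memK, Set.mem_ofPred_eq] at h h'
      simp only [Prod.mk.injEq] at e ⊢
      obtain ⟨rfl, rfl⟩ := e
      obtain ⟨h, rfl⟩ := h
      obtain ⟨h', rfl⟩ := h'
      have hw : w ^ 2 = w' ^ 2 := by omega
      exact ⟨⟨rfl, rfl⟩, rfl, Nat.pow_left_injective two_ne_zero hw⟩
  have c2 : (K.filter (fun p => p.2.1 < p.1.1)).card ≤ (equalProducts M).card := by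
    refine Finset.card_le_card_of_injOn
      (fun p => (p.1.1 - p.2.1, p.2.2 - p.1.2, p.1.1 + p.2.1, p.2.2 + p.1.2)) ?_ ?_
    · rintro ⟨⟨x, y⟩, z, w⟩ h
      simp only [Finset.coe_filter, memK, Set.mem_ofPred_eq] at h
      have hy := gt_side x y z w h.2 h.1.2
      simp only [Finset.mem_coe, memE]
      refine ⟨⟨by omega, by omega, by omega, by omega⟩, ?_⟩
      obtain ⟨d, rfl⟩ := Nat.exists_eq_add_of_lt h.2
      obtain ⟨e, rfl⟩ := Nat.exists_eq_add_of_lt hy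
      rw [show z + d + 1 - z = d + 1 by omega, show y + e + 1 - y = e + 1 by omega]
      nlinarith [h.1.2]
    · rintro ⟨⟨x, y⟩, z, w⟩ h ⟨⟨x', y'⟩, z', w'⟩ h' e
      simp only [Finset.coe_filter, memK, Set.mem_ofPred_eq] at h h'
      have hy := gt_side x y z w h.2 h.1.2
      have hy' := gt_side x' y' z' w' h'.2 h'.1.2
      simp only [Prod.mk.injEq] at e ⊢
      omega
  have c3 : (K.filter (fun p => p.1.1 < p.2.1)).card ≤
      (K.filter (fun p => p.2.1 < p.1.1)).card := by
    refine Finset.card_le_card_of_injOn Prod.swap ?_ Prod.swap_injective.injOn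
    rintro ⟨⟨x, y⟩, z, w⟩ h
    simp only [Finset.coe_filter, memK, Set.mem_ofPred_eq, Prod.swap_prod_mk] at h ⊢
    exact ⟨⟨⟨h.1.1.2, h.1.1.1⟩, h.1.2.symm⟩, h.2⟩
  rw [split]
  refine (Finset.card_union_le _ _).trans ?_
  have := Finset.card_union_le (K.filter (fun p => p.2.1 < p.1.1))
    (K.filter (fun p => p.1.1 < p.2.1))
  omega

lemma sq_le_card_sumsOfSquares_mul (M : ℕ) :
    (M : ℝ) ^ 2 ≤ ((sumsOfSquares M).card : ℝ) * (1 + 8 * (1 + Real.log M)) := by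
  rcases Nat.eq_zero_or_pos M with rfl | hM
  · simp; positivity
  have h1 := sq_card_le_card_image_mul_card_collisions (Finset.Icc 1 M ×ˢ Finset.Icc 1 M)
    (fun p => p.1 ^ 2 + p.2 ^ 2)
  have h2 := h1.trans (Nat.mul_le_mul_left _ (card_collisions_sumsOfSquares_le M))
  rw [Finset.card_product, Nat.card_Icc, Nat.add_sub_cancel] at h2
  have h3 : ((M : ℝ) * M) ^ 2 ≤ ((sumsOfSquares M).card : ℝ) *
      ((M : ℝ) ^ 2 + 2 * ((equalProducts M).card : ℝ)) := by
    exact_mod_cast h2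
  have h4 := card_equalProducts_le M
  have hM' : (0 : ℝ) < (M : ℝ) ^ 2 := by positivity
  refine le_of_mul_le_mul_left ?_ hM'
  calc (M : ℝ) ^ 2 * (M : ℝ) ^ 2 = ((M : ℝ) * M) ^ 2 := by ring
    _ ≤ _ := h3
    _ ≤ ((sumsOfSquares M).card : ℝ) *
      ((M : ℝ) ^ 2 + 2 * (4 * (M : ℝ) ^ 2 * (1 + Real.log M))) := by gcongr
    _ = _ := by ring

lemma infinite_setOf_isSumTwoSquares : {n | IsSumTwoSquares n}.Infinite := by
  refine Set.infinite_of_injective_forall_mem (f := fun n : ℕ => n ^ 2)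
    (Nat.pow_left_injective two_ne_zero) fun n => ⟨n, 0, by push_cast; ring⟩

lemma a_le_of_le_card_sumsOfSquares {M N : ℕ} (hN : 0 < N) (h : N ≤ (sumsOfSquares M).card) :
    a N ≤ 2 * M ^ 2 := by
  have : N - 1 < Nat.count IsSumTwoSquares (2 * M ^ 2 + 1) := by
    rw [Nat.count_eq_card_filter_range]
    refine lt_of_lt_of_le (Nat.sub_lt hN one_pos) (h.trans (Finset.card_le_card ?_))
    intro n hn
    simp only [sumsOfSquares, Finset.mem_image, Finset.mem_product, Finset.mem_Icc] at hn
    obtain ⟨⟨x, y⟩, ⟨hx, hy⟩, rfl⟩ := hn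
    simp only [Finset.mem_filter, Finset.mem_range]
    exact ⟨by nlinarith [Nat.pow_le_pow_left hx.2 2, Nat.pow_le_pow_left hy.2 2],
      x, y, by push_cast; ring⟩
  exact Nat.lt_succ_iff.mp (Nat.nth_lt_of_lt_count this)

/-- The upper bound `a n ≪ n log n` along the sequence `n = 7 · 64 ^ j`. -/
lemma a_seven_mul_pow_le (j : ℕ) : a (7 * 64 ^ j) ≤ 8192 * 64 ^ j * (j + 1) := by
  set X : ℕ := 1024 * 64 ^ j * (j + 1) with hX
  set M : ℕ := Nat.sqrt X + 1 with hM
  have hXpos : 1 ≤ X := Nat.succ_le_of_lt (by positivity)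
  have hlow : X ≤ M ^ 2 := by
    have := Nat.lt_succ_sqrt' X
    exact this.le
  have hs1 : 1 ≤ Nat.sqrt X := Nat.le_sqrt'.mpr (by simpa using hXpos)
  have hup : M ^ 2 ≤ 4 * X := by
    have := Nat.sqrt_le' X
    rw [hM]; nlinarith
  have hcard : 7 * 64 ^ j ≤ (sumsOfSquares M).card := by
    have h1 := sq_le_card_sumsOfSquares_mul M
    have hlog2 : Real.log 2 < 0.6931471808 := Real.log_two_lt_d9
    have hlog : Real.log M ≤ 7 * ((j : ℝ) + 1) := by
      have e1 : 2 * Real.log M = Real.log ((M : ℝ) ^ 2) := by rw [Real.log_pow]; norm_num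
      have e2 : Real.log ((M : ℝ) ^ 2) ≤ Real.log ((2 : ℝ) ^ 12 * (2 ^ 6) ^ j * (j + 1)) := by
        apply Real.log_le_log (by positivity)
        have : ((M ^ 2 : ℕ) : ℝ) ≤ ((4 * X : ℕ) : ℝ) := by exact_mod_cast hup
        rw [hX] at this
        push_cast at this
        norm_num at this ⊢
        linarith
      rw [Real.log_mul (by positivity) (by positivity), Real.log_mul (by positivity) (by positivity),
        ← pow_mul, Real.log_pow, Real.log_pow, Real.log_pow] at e2
      have e3 : Real.log ((j : ℝ) + 1) ≤ j := by
        have := Real.log_le_sub_one_of_pos (show (0 : ℝ) < (j : ℝ) + 1 by positivity)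
        linarith
      push_cast at e2
      have : (j : ℝ) * Real.log 2 ≤ j * 0.6931471808 := by gcongr
      nlinarith
    have h2 : (1024 : ℝ) * 64 ^ j * (j + 1) ≤
        ((sumsOfSquares M).card : ℝ) * (65 * ((j : ℝ) + 1)) := by
      have : ((X : ℕ) : ℝ) ≤ ((M ^ 2 : ℕ) : ℝ) := by exact_mod_cast hlow
      rw [hX] at this
      push_cast at this
      refine this.trans (h1.trans ?_)
      gcongr
      have : (0 : ℝ) ≤ j := by positivity
      linarith
    have h3 : (1024 : ℝ) * 64 ^ j ≤ ((sumsOfSquares M).card : ℝ) * 65 := by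
      refine le_of_mul_le_mul_right ?_ (show (0 : ℝ) < (j : ℝ) + 1 by positivity)
      linarith
    have h4 : (7 : ℝ) * 64 ^ j ≤ ((sumsOfSquares M).card : ℝ) := by
      have : (0 : ℝ) < 64 ^ j := by positivity
      linarith
    exact_mod_cast h4
  calc a (7 * 64 ^ j) ≤ 2 * M ^ 2 := a_le_of_le_card_sumsOfSquares (by positivity) hcard
    _ ≤ 2 * (4 * X) := by gcongr
    _ = _ := by rw [hX]; ring

lemma a_lt_a {m n : ℕ} (hm : 1 ≤ m) (h : m < n) : a m < a n :=
  Nat.nth_strictMono infinite_setOf_isSumTwoSquares (by omega)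

lemma a_mono : Monotone a := fun _ _ h =>
  (Nat.nth_strictMono infinite_setOf_isSumTwoSquares).monotone (Nat.sub_le_sub_right h 1)

/-- Pairs `1 ≤ n < m ≤ N` with `a n` and `a m` congruent modulo `q`. -/
noncomputable def congruentPairs (N q : ℕ) : Finset (ℕ × ℕ) :=
  (Finset.Icc 1 N ×ˢ Finset.Icc 1 N).filter (fun p => p.1 < p.2 ∧ a p.1 % q = a p.2 % q)

lemma sq_le_mul_card_congruentPairs (N : ℕ) {q : ℕ} (hq : 0 < q) :
    N ^ 2 ≤ q * (N + 2 * (congruentPairs N q).card) := by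
  have h1 := sq_card_le_card_image_mul_card_collisions (Finset.Icc 1 N) (fun n => a n % q)
  have h2 : ((Finset.Icc 1 N).image (fun n => a n % q)).card ≤ q := by
    calc _ ≤ (Finset.range q).card := Finset.card_le_card fun x hx => by
            obtain ⟨n, -, rfl⟩ := Finset.mem_image.mp hx
            exact Finset.mem_range.mpr (Nat.mod_lt _ hq)
      _ = q := Finset.card_range q
  set K := (Finset.Icc 1 N ×ˢ Finset.Icc 1 N).filter
    (fun p : ℕ × ℕ => a p.1 % q = a p.2 % q) with hK
  have split : K ⊆ (Finset.Icc 1 N).image (fun n => (n, n)) ∪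
      (congruentPairs N q ∪ (congruentPairs N q).image Prod.swap) := by
    rintro ⟨x, y⟩ h
    simp only [hK, Finset.mem_filter, Finset.mem_product] at h
    simp only [congruentPairs, Finset.mem_union, Finset.mem_image, Finset.mem_filter,
      Finset.mem_product]
    rcases lt_trichotomy x y with hxy | rfl | hxy
    · exact Or.inr (Or.inl ⟨h.1, hxy, h.2⟩)
    · exact Or.inl ⟨x, h.1.1, rfl⟩
    · exact Or.inr (Or.inr ⟨(y, x), ⟨⟨h.1.2, h.1.1⟩, hxy, h.2.symm⟩, rfl⟩)
  have h3 : K.card ≤ N + 2 * (congruentPairs N q).card := by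
    refine (Finset.card_le_card split).trans ((Finset.card_union_le _ _).trans ?_)
    have i1 := Finset.card_union_le (congruentPairs N q) ((congruentPairs N q).image Prod.swap)
    have i2 : ((congruentPairs N q).image Prod.swap).card ≤ _ := Finset.card_image_le
    have i3 : ((Finset.Icc 1 N).image (fun n => (n, n))).card ≤ _ := Finset.card_image_le
    rw [Nat.card_Icc] at i3
    omega
  rw [Nat.card_Icc, Nat.add_sub_cancel] at h1
  exact h1.trans (Nat.mul_le_mul h2 h3)

lemma nint_natCast_mul_le {α : ℝ} {r : ℚ} {v : ℕ} (hv : r.den ∣ v) :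
    nint (v * α) ≤ v * |α - r| := by
  obtain ⟨k, rfl⟩ := hv
  have h := round_le (((r.den * k : ℕ) : ℝ) * α) (k * r.num : ℤ)
  refine h.trans (le_of_eq ?_)
  have hr : (r : ℝ) * r.den = r.num := by exact_mod_cast Rat.mul_den_eq_num r
  have e : ((r.den * k : ℕ) : ℝ) * α - ((k * r.num : ℤ) : ℝ) = ((r.den * k : ℕ) : ℝ) * (α - r) := by
    push_cast
    rw [← hr]
    ring
  rw [e, abs_mul, abs_of_nonneg (Nat.cast_nonneg _)]

lemma card_congruentPairs_le_sum {α : ℝ} {N : ℕ} {r : ℚ} {s : ℝ}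
    (h : (a N : ℝ) * |α - r| ≤ s / N) :
    ((congruentPairs N r.den).card : ℝ) ≤ ∑ v ∈ Finset.Icc 1 (a N),
      (R N v : ℝ) * (if nint (v * α) ≤ s / N then 1 else 0) := by
  rw [Finset.card_eq_sum_card_fiberwise (f := fun p : ℕ × ℕ => a p.2 - a p.1)
    (t := Finset.Icc 1 (a N))]
  · push_cast
    refine Finset.sum_le_sum fun v hv => ?_
    rw [Finset.mem_Icc] at hv
    by_cases hd : r.den ∣ v
    · have hn : nint (v * α) ≤ s / N := by
        refine (nint_natCast_mul_le hd).trans (le_trans ?_ h)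
        have : (v : ℝ) ≤ a N := by exact_mod_cast hv.2
        gcongr
      rw [if_pos hn, mul_one, Nat.cast_le]
      refine Finset.card_le_card fun p hp => ?_
      simp only [congruentPairs, Finset.mem_filter] at hp ⊢
      exact ⟨hp.1.1, hp.1.2.1, hp.2⟩
    · have : (congruentPairs N r.den).filter (fun p => a p.2 - a p.1 = v) = ∅ := by
        refine Finset.filter_eq_empty_iff.mpr fun p hp e => hd ?_
        simp only [congruentPairs, Finset.mem_filter, Finset.mem_product, Finset.mem_Icc] at hp
        rw [← e]
        exact (Nat.modEq_iff_dvd' (a_mono hp.2.1.le)).mp hp.2.2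
      rw [this, Finset.card_empty, Nat.cast_zero]
      positivity
  · intro p hp
    simp only [congruentPairs, Finset.coe_filter, Finset.mem_product, Finset.mem_Icc,
      Set.mem_ofPred_eq] at hp
    have h1 := a_lt_a hp.1.1.1 hp.2.1
    have h2 := a_mono hp.1.2.2
    simp only [Finset.coe_Icc, Set.mem_Icc]
    omega

/-- If `α` is very close to a rational whose denominator is at most `N / 7`, then the pair
correlation function at scale `1` is at least `3`. -/
lemma three_le_T {α : ℝ} {N : ℕ} {r : ℚ} (hN : 7 * r.den ≤ N)
    (h : (a N : ℝ) * |α - r| ≤ 1 / N) : 3 ≤ T α N 1 := by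
  have hd : 0 < r.den := r.den_pos
  have h1 := sq_le_mul_card_congruentPairs N hd
  have h2 : 3 * N ≤ (congruentPairs N r.den).card := by
    have : 7 * N ≤ N + 2 * (congruentPairs N r.den).card := by
      refine Nat.le_of_mul_le_mul_left ?_ hd
      calc r.den * (7 * N) = (7 * r.den) * N := by ring
        _ ≤ N * N := by gcongr
        _ = N ^ 2 := (sq N).symm
        _ ≤ _ := h1
    omega
  have hNpos : (0 : ℝ) < N := by
    have : 0 < N := by omega
    exact_mod_cast this
  have h3 := card_congruentPairs_le_sum h
  have h4 : (3 : ℝ) * N ≤ (congruentPairs N r.den).card := by exact_mod_cast h2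
  rw [T, one_div_mul_eq_div, le_div_iff₀ hNpos]
  exact h4.trans h3

/-- The rationals in `[0, 1]` whose reduced denominator lies in `(Q / 8, Q]`. -/
noncomputable def fareyBlock (Q : ℕ) : Finset ℚ :=
  ((Finset.range (Q + 1) ×ˢ Finset.range (Q + 1)).image (fun p => (p.1 / p.2 : ℚ))).filter
    (fun r => Q < 8 * r.den ∧ r.den ≤ Q ∧ 0 ≤ r ∧ r ≤ 1)

lemma num_toNat_div_den {r : ℚ} (h0 : 0 ≤ r) : ((r.num.toNat : ℕ) : ℚ) / r.den = r := by
  have h : ((r.num.toNat : ℕ) : ℚ) = r.num := by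
    exact_mod_cast Int.toNat_of_nonneg (Rat.num_nonneg.mpr h0)
  rw [h, Rat.num_div_den]

lemma num_toNat_le_den {r : ℚ} (h1 : r ≤ 1) : r.num.toNat ≤ r.den := by
  have := (Rat.le_iff r 1).mp h1
  simp at this
  omega

lemma mem_fareyBlock {Q : ℕ} {r : ℚ} :
    r ∈ fareyBlock Q ↔ Q < 8 * r.den ∧ r.den ≤ Q ∧ 0 ≤ r ∧ r ≤ 1 := by
  simp only [fareyBlock, Finset.mem_filter, and_iff_right_iff_imp, Finset.mem_image,
    Finset.mem_product, Finset.mem_range]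
  rintro ⟨-, h, h0, h1⟩
  have := num_toNat_le_den h1
  exact ⟨(r.num.toNat, r.den), ⟨by simp only; omega, by simp only; omega⟩, num_toNat_div_den h0⟩

/-- Distinct rationals with denominators at most `Q` are at distance at least `1 / Q ^ 2`. -/
lemma one_div_sq_le_abs_sub {Q : ℕ} {r r' : ℚ} (hr : r.den ≤ Q) (hr' : r'.den ≤ Q) (h : r ≠ r') :
    1 / (Q : ℝ) ^ 2 ≤ |(r : ℝ) - r'| := by
  have hd : (0 : ℝ) < r.den := by exact_mod_cast r.den_pos
  have hd' : (0 : ℝ) < r'.den := by exact_mod_cast r'.den_pos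
  have hn : (1 : ℝ) ≤ |(r : ℝ) - r'| * (r.den * r'.den) := by
    have e : ((r : ℝ) - r') * (r.den * r'.den) =
        ((r.num * r'.den - r'.num * r.den : ℤ) : ℝ) := by
      have e1 : (r : ℝ) * r.den = r.num := by exact_mod_cast Rat.mul_den_eq_num r
      have e2 : (r' : ℝ) * r'.den = r'.num := by exact_mod_cast Rat.mul_den_eq_num r'
      push_cast
      rw [← e1, ← e2]
      ring
    have hne : r.num * r'.den - r'.num * r.den ≠ 0 := by
      intro h0
      exact h (Rat.eq_iff_mul_eq_mul.mpr (sub_eq_zero.mp h0))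
    have : |(r : ℝ) - r'| * (r.den * r'.den) = |((r : ℝ) - r') * (r.den * r'.den)| := by
      rw [abs_mul, abs_of_pos (mul_pos hd hd')]
    rw [this, e, ← Int.cast_abs]
    exact_mod_cast Int.one_le_abs hne
  have hQ : (0 : ℝ) < Q := lt_of_lt_of_le hd (by exact_mod_cast hr)
  rw [div_le_iff₀ (by positivity)]
  refine hn.trans ?_
  rw [sq]
  gcongr

/-- Upper bound for the number of rationals with bounded denominators in a short interval. -/
lemma card_le_of_abs_sub_le {Q : ℕ} {S : Finset ℚ} {x w : ℝ} (hQ : 0 < Q) (hw : 0 ≤ w)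
    (hden : ∀ r ∈ S, r.den ≤ Q) (hS : ∀ r ∈ S, |(r : ℝ) - x| ≤ w) :
    (S.card : ℝ) ≤ 2 * w * (Q : ℝ) ^ 2 + 2 := by
  have hQ' : (0 : ℝ) < (Q : ℝ) ^ 2 := by positivity
  have h1 : S.card ≤
      (Finset.Icc ⌊(x - w) * (Q : ℝ) ^ 2⌋ ⌊(x + w) * (Q : ℝ) ^ 2⌋).card := by
    refine Finset.card_le_card_of_injOn (fun r => ⌊(r : ℝ) * (Q : ℝ) ^ 2⌋) ?_ ?_
    · intro r hr
      have := abs_le.mp (hS r hr)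
      simp only [Finset.coe_Icc, Set.mem_Icc]
      constructor
      · apply Int.floor_le_floor
        gcongr
        linarith
      · apply Int.floor_le_floor
        gcongr
        linarith
    · intro r hr r' hr' e
      by_contra hne
      have h2 := one_div_sq_le_abs_sub (hden r hr) (hden r' hr') hne
      have h3 := Int.abs_sub_lt_one_of_floor_eq_floor e
      rw [← sub_mul, abs_mul, abs_of_pos hQ'] at h3
      rw [div_le_iff₀ hQ'] at h2
      linarith
  rw [Int.card_Icc] at h1
  have h4 : (((⌊(x + w) * (Q : ℝ) ^ 2⌋ + 1 - ⌊(x - w) * (Q : ℝ) ^ 2⌋).toNat : ℤ) : ℝ) ≤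
      2 * w * (Q : ℝ) ^ 2 + 2 := by
    have f1 := Int.floor_le ((x + w) * (Q : ℝ) ^ 2)
    have f2 := Int.lt_floor_add_one ((x - w) * (Q : ℝ) ^ 2)
    have f3 : (0 : ℝ) ≤ w * (Q : ℝ) ^ 2 := by positivity
    rw [Int.toNat_eq_max]
    push_cast
    refine max_le ?_ ?_ <;> nlinarith
  refine le_trans ?_ h4
  exact_mod_cast h1

lemma abs_sub_half_le {Q : ℕ} {r : ℚ} (hr : r ∈ fareyBlock Q) : |(r : ℝ) - 1 / 2| ≤ 1 / 2 := by
  obtain ⟨-, -, h0, h1⟩ := mem_fareyBlock.mp hr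
  have h0' : (0 : ℝ) ≤ r := by exact_mod_cast h0
  have h1' : (r : ℝ) ≤ 1 := by exact_mod_cast h1
  rw [abs_le]
  constructor <;> linarith

lemma card_fareyBlock_le {Q : ℕ} (hQ : 0 < Q) :
    ((fareyBlock Q).card : ℝ) ≤ 3 * (Q : ℝ) ^ 2 := by
  have h := card_le_of_abs_sub_le hQ (by norm_num : (0 : ℝ) ≤ 1 / 2)
    (fun r hr => (mem_fareyBlock.mp hr).2.1) (fun r hr => abs_sub_half_le (Q := Q) hr)
  have : (1 : ℝ) ≤ (Q : ℝ) ^ 2 := one_le_pow₀ (by exact_mod_cast hQ)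
  linarith

/-- A rational approximation of Dirichlet quality to a point of `[0, 1]` lies in `[0, 1]`. -/
lemma mem_unitInterval_of_approx {Q : ℕ} (hQ : 0 < Q) {x : ℝ} (hx : x ∈ Set.Icc (0 : ℝ) 1) {r : ℚ}
    (h : |x - r| ≤ 1 / ((Q + 1) * r.den)) : 0 ≤ r ∧ r ≤ 1 := by
  have hd : (0 : ℝ) < r.den := by exact_mod_cast r.den_pos
  have hQ' : (0 : ℝ) < Q := by exact_mod_cast hQ
  have e : (r : ℝ) * r.den = r.num := by exact_mod_cast Rat.mul_den_eq_num r
  have hlt : |x - r| * r.den < 1 := by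
    calc |x - r| * r.den ≤ 1 / ((Q + 1) * r.den) * r.den := by gcongr
      _ = 1 / (Q + 1) := by field_simp
      _ < 1 := by rw [div_lt_one (by positivity)]; linarith
  have hle := abs_le.mp (le_refl |x - r|)
  constructor
  · have : (-1 : ℝ) < r.num := by
      rw [← e]
      nlinarith [hx.1]
    have : -1 < r.num := by exact_mod_cast this
    exact Rat.num_nonneg.mp (by omega)
  · have : (r.num : ℝ) < r.den + 1 := by
      rw [← e]
      nlinarith [hx.2]
    have : r.num < r.den + 1 := by exact_mod_cast this
    rw [Rat.le_iff]
    simp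
    omega

/-- By Dirichlet's theorem, a positive proportion of the `Q ^ 2` expected fractions occurs. -/
lemma sq_le_card_fareyBlock {Q : ℕ} (hQ : 0 < Q) :
    (Q : ℝ) ^ 2 / 32 ≤ ((fareyBlock Q).card : ℝ) := by
  have hQ' : (0 : ℝ) < Q := by exact_mod_cast hQ
  set S₁ : Set ℝ := ⋃ r ∈ fareyBlock Q, Metric.closedBall (r : ℝ) (8 / (Q : ℝ) ^ 2) with hS₁
  set S₂ : Set ℝ := ⋃ d ∈ Finset.Icc 1 (Q / 8), ⋃ p ∈ Finset.range (d + 1),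
    Metric.closedBall ((p : ℝ) / d) (1 / ((Q + 1) * d)) with hS₂
  have hcover : Set.Icc (0 : ℝ) 1 ⊆ S₁ ∪ S₂ := by
    intro x hx
    obtain ⟨r, hr, hrQ⟩ := Real.exists_rat_abs_sub_le_and_den_le x hQ
    obtain ⟨h0, h1⟩ := mem_unitInterval_of_approx hQ hx hr
    have hd : (0 : ℝ) < r.den := by exact_mod_cast r.den_pos
    by_cases hlarge : Q < 8 * r.den
    · left
      simp only [hS₁, Set.mem_iUnion]
      refine ⟨r, mem_fareyBlock.mpr ⟨hlarge, hrQ, h0, h1⟩, ?_⟩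
      rw [Metric.mem_closedBall, Real.dist_eq]
      refine hr.trans ?_
      rw [div_le_div_iff₀ (by positivity) (by positivity)]
      have : (Q : ℝ) ≤ 8 * r.den := by exact_mod_cast hlarge.le
      nlinarith
    · right
      simp only [hS₂, Set.mem_iUnion]
      refine ⟨r.den, Finset.mem_Icc.mpr ⟨r.den_pos, by omega⟩, r.num.toNat,
        Finset.mem_range.mpr (Nat.lt_succ_of_le (num_toNat_le_den h1)), ?_⟩
      have e : ((r.num.toNat : ℕ) : ℝ) / r.den = r := by
        rw [← Rat.cast_natCast, ← Rat.cast_natCast (r.den), ← Rat.cast_div, num_toNat_div_den h0]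
      rw [e, Metric.mem_closedBall, Real.dist_eq]
      exact hr
  have hS₁fin : volume S₁ ≠ ⊤ := ((measure_biUnion_finset_le _ _).trans_lt
    (ENNReal.sum_lt_top.mpr fun r _ => measure_closedBall_lt_top)).ne
  have hS₂fin : volume S₂ ≠ ⊤ := ((measure_biUnion_finset_le _ _).trans_lt
    (ENNReal.sum_lt_top.mpr fun d _ => (measure_biUnion_finset_le _ _).trans_lt
      (ENNReal.sum_lt_top.mpr fun r _ => measure_closedBall_lt_top))).ne
  have hv₁ : volume.real S₁ ≤ (fareyBlock Q).card * (16 / (Q : ℝ) ^ 2) := by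
    refine (measureReal_biUnion_finset_le _ _).trans (le_of_eq ?_)
    rw [Finset.sum_congr rfl (fun r _ => Real.volume_real_closedBall (by positivity)),
      Finset.sum_const, nsmul_eq_mul]
    ring
  have hv₂ : volume.real S₂ ≤ 1 / 2 := by
    have hterm : ∀ d ∈ Finset.Icc 1 (Q / 8), volume.real (⋃ p ∈ Finset.range (d + 1),
        Metric.closedBall ((p : ℝ) / d) (1 / ((Q + 1) * d))) ≤ 4 / (Q + 1) := by
      intro d hd
      have hd1 : (1 : ℝ) ≤ d := by exact_mod_cast (Finset.mem_Icc.mp hd).1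
      refine (measureReal_biUnion_finset_le _ _).trans ?_
      rw [Finset.sum_congr rfl (fun r _ => Real.volume_real_closedBall (by positivity)),
        Finset.sum_const, nsmul_eq_mul, Finset.card_range]
      push_cast
      have : ((d : ℝ) + 1) * (2 * (1 / ((Q + 1) * d))) = (2 * (d + 1) / d) / (Q + 1) := by
        field_simp
      rw [this]
      gcongr
      rw [div_le_iff₀ (by positivity)]
      linarith
    calc volume.real S₂ ≤ _ := measureReal_biUnion_finset_le _ _
      _ ≤ ∑ d ∈ Finset.Icc 1 (Q / 8), (4 / ((Q : ℝ) + 1)) := Finset.sum_le_sum hterm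
      _ = ((Q / 8 : ℕ) : ℝ) * (4 / (Q + 1)) := by
        rw [Finset.sum_const, nsmul_eq_mul, Nat.card_Icc, Nat.add_sub_cancel]
      _ ≤ (Q / 8) * (4 / (Q + 1)) := by
        gcongr
        exact_mod_cast (Nat.cast_div_le (α := ℝ) (m := Q) (n := 8))
      _ ≤ 1 / 2 := by
        rw [div_mul_div_comm, div_le_div_iff₀ (by positivity) (by positivity)]
        linarith
  have hone : (1 : ℝ) ≤ volume.real S₁ + volume.real S₂ := by
    have : volume.real (Set.Icc (0 : ℝ) 1) = 1 := by simp
    rw [← this]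
    exact (measureReal_mono hcover (measure_union_ne_top hS₁fin hS₂fin)).trans
      (measureReal_union_le _ _)
  have h16 : (1 : ℝ) / 2 ≤ (fareyBlock Q).card * (16 / (Q : ℝ) ^ 2) := by linarith
  rw [mul_div_assoc', le_div_iff₀ (by positivity)] at h16
  linarith

/-- The radius of approximation attached to the denominators of size `64 ^ j`. -/
noncomputable def approxRadius (j : ℕ) : ℝ := 1 / 57344 * (1 / ((j : ℝ) + 1)) / 4096 ^ j

lemma approxRadius_pos (j : ℕ) : 0 < approxRadius j := by
  unfold approxRadius
  positivity

lemma approxRadius_anti {j k : ℕ} (h : j ≤ k) : approxRadius k ≤ approxRadius j := by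
  unfold approxRadius
  gcongr
  norm_num

lemma approxRadius_mul_pow (j : ℕ) :
    approxRadius j * 4096 ^ j = 1 / 57344 * (1 / ((j : ℝ) + 1)) := by
  unfold approxRadius
  field_simp

lemma cast_pow_sixtyFour_sq (j : ℕ) : (((64 ^ j : ℕ) : ℝ)) ^ 2 = 4096 ^ j := by
  push_cast
  rw [← pow_mul, mul_comm, pow_mul]
  norm_num

lemma two_mul_approxRadius_lt (j : ℕ) : 2 * approxRadius j < 1 / (4096 : ℝ) ^ j := by
  rw [lt_div_iff₀ (by positivity), mul_assoc, approxRadius_mul_pow]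
  have : 1 / ((j : ℝ) + 1) ≤ 1 := by
    rw [div_le_one (by positivity)]
    linarith [(Nat.cast_nonneg j : (0 : ℝ) ≤ j)]
  linarith

/-- The numbers within `approxRadius j` of a fraction in `[0, 1]` with denominator of
size `64 ^ j`. -/
noncomputable def approxSet (j : ℕ) : Set ℝ :=
  ⋃ r ∈ fareyBlock (64 ^ j), Metric.ball (r : ℝ) (approxRadius j)

lemma isOpen_approxSet (j : ℕ) : IsOpen (approxSet j) :=
  isOpen_biUnion fun _ _ => Metric.isOpen_ball

lemma mem_approxSet {j : ℕ} {x : ℝ} :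
    x ∈ approxSet j ↔ ∃ r ∈ fareyBlock (64 ^ j), |x - r| < approxRadius j := by
  simp [approxSet, Real.dist_eq]

lemma approxSet_subset_Ico {j : ℕ} (hj : 1 ≤ j) : approxSet j ⊆ Set.Ico 0 1 := by
  intro x hx
  obtain ⟨r, hr, hxr⟩ := mem_approxSet.mp hx
  obtain ⟨h8, hQ, h0, h1⟩ := mem_fareyBlock.mp hr
  have h64 : 64 ≤ 64 ^ j := Nat.le_self_pow (by omega) 64
  have hrad := two_mul_approxRadius_lt j
  have hpos := approxRadius_pos j
  have hone : 1 ≤ 64 ^ j := by omega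
  have hne0 : r ≠ 0 := by
    rintro rfl
    simp only [Rat.den_ofNat] at h8
    omega
  have hne1 : r ≠ 1 := by
    rintro rfl
    simp only [Rat.den_ofNat] at h8
    omega
  have d0 := one_div_sq_le_abs_sub hQ (by simpa using hone) hne0
  have d1 := one_div_sq_le_abs_sub hQ (by simpa using hone) hne1
  rw [cast_pow_sixtyFour_sq] at d0 d1
  have h0' : (0 : ℝ) ≤ r := by exact_mod_cast h0
  have h1' : (r : ℝ) ≤ 1 := by exact_mod_cast h1
  rw [Rat.cast_zero, sub_zero, abs_of_nonneg h0'] at d0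
  rw [Rat.cast_one, abs_of_nonpos (by linarith)] at d1
  rw [abs_lt] at hxr
  constructor <;> linarith

/-- The union of the approximation sets with index in `[i, m)`. -/
noncomputable def approxUnion (i m : ℕ) : Set ℝ := ⋃ j ∈ Finset.Ico i m, approxSet j

lemma approxUnion_subset_Ico {i m : ℕ} (hi : 1 ≤ i) : approxUnion i m ⊆ Set.Ico 0 1 :=
  Set.iUnion₂_subset fun _ hj => approxSet_subset_Ico (hi.trans (Finset.mem_Ico.mp hj).1)

lemma volume_ne_top_of_subset_Ico {S : Set ℝ} (h : S ⊆ Set.Ico 0 1) : volume S ≠ ⊤ :=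
  ((measure_mono h).trans_lt measure_Ico_lt_top).ne

/-- The partial harmonic sums controlling the measure of `approxUnion`. -/
noncomputable def harmonicBlock (i m : ℕ) : ℝ :=
  1 / 57344 * ∑ j ∈ Finset.Ico i m, 1 / ((j : ℝ) + 1)

/-- The fractions of size `64 ^ m` whose intervals avoid all earlier intervals. -/
noncomputable def freshFractions (i m : ℕ) : Finset ℚ :=
  (fareyBlock (64 ^ m)).filter (fun r => ∀ j ∈ Finset.Ico i m, ∀ r' ∈ fareyBlock (64 ^ j),
    2 * approxRadius j < |(r : ℝ) - r'|)

lemma mem_freshFractions {i m : ℕ} {r : ℚ} :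
    r ∈ freshFractions i m ↔ r ∈ fareyBlock (64 ^ m) ∧ ∀ j ∈ Finset.Ico i m,
      ∀ r' ∈ fareyBlock (64 ^ j), 2 * approxRadius j < |(r : ℝ) - r'| := by
  simp only [freshFractions, Finset.mem_filter]

lemma sum_Ico_pow_le (i m : ℕ) :
    ∑ j ∈ Finset.Ico i m, (4096 : ℝ) ^ j ≤ 4096 ^ m / 4095 := by
  calc ∑ j ∈ Finset.Ico i m, (4096 : ℝ) ^ j ≤ ∑ j ∈ Finset.range m, (4096 : ℝ) ^ j := by
        rw [Finset.range_eq_Ico]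
        exact Finset.sum_le_sum_of_subset_of_nonneg
          (Finset.Ico_subset_Ico_left (Nat.zero_le i)) fun _ _ _ => by positivity
    _ = (4096 ^ m - 1) / (4096 - 1) := geom_sum_eq (by norm_num) m
    _ ≤ _ := by norm_num; gcongr; linarith

lemma card_freshFractions_ge {i m : ℕ} (h : harmonicBlock i m ≤ 1 / 1000) :
    (4096 : ℝ) ^ m / 64 ≤ (freshFractions i m).card := by
  have hQ : ∀ j : ℕ, 0 < 64 ^ j := fun j => by positivity
  have hsub : fareyBlock (64 ^ m) ⊆ freshFractions i m ∪
      (Finset.Ico i m).biUnion (fun j => (fareyBlock (64 ^ j)).biUnion (fun r' =>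
        (fareyBlock (64 ^ m)).filter (fun r : ℚ => |(r : ℝ) - r'| ≤ 2 * approxRadius j))) := by
    intro r hr
    by_cases hf : r ∈ freshFractions i m
    · exact Finset.mem_union_left _ hf
    · refine Finset.mem_union_right _ ?_
      simp only [mem_freshFractions, hr, true_and, not_forall, not_lt] at hf
      obtain ⟨j, hj, r', hr', hle⟩ := hf
      simp only [Finset.mem_biUnion, Finset.mem_filter]
      exact ⟨j, hj, r', hr', hr, hle⟩
  have hbad : ∀ j ∈ Finset.Ico i m, (((fareyBlock (64 ^ j)).biUnion (fun r' =>
      (fareyBlock (64 ^ m)).filter (fun r : ℚ => |(r : ℝ) - r'| ≤ 2 * approxRadius j))).card : ℝ) ≤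
      12 * 4096 ^ m * (1 / 57344 * (1 / ((j : ℝ) + 1))) + 6 * 4096 ^ j := by
    intro j _
    have c1 : (((fareyBlock (64 ^ j)).biUnion (fun r' =>
      (fareyBlock (64 ^ m)).filter (fun r : ℚ => |(r : ℝ) - r'| ≤ 2 * approxRadius j))).card : ℝ) ≤
      ∑ r' ∈ fareyBlock (64 ^ j), (((fareyBlock (64 ^ m)).filter
        (fun r : ℚ => |(r : ℝ) - r'| ≤ 2 * approxRadius j)).card : ℝ) := by
      exact_mod_cast Finset.card_biUnion_le
    have hrad := approxRadius_pos j
    have c2 : ∀ r' ∈ fareyBlock (64 ^ j), (((fareyBlock (64 ^ m)).filter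
        (fun r : ℚ => |(r : ℝ) - r'| ≤ 2 * approxRadius j)).card : ℝ) ≤
        2 * (2 * approxRadius j) * 4096 ^ m + 2 := by
      intro r' _
      have hden : ∀ r ∈ (fareyBlock (64 ^ m)).filter
          (fun r : ℚ => |(r : ℝ) - r'| ≤ 2 * approxRadius j), r.den ≤ 64 ^ m := fun r hr =>
        (mem_fareyBlock.mp (Finset.mem_filter.mp hr).1).2.1
      have hle := card_le_of_abs_sub_le (w := 2 * approxRadius j) (hQ m) (by positivity) hden
        (fun r hr => (Finset.mem_filter.mp hr).2)
      rwa [cast_pow_sixtyFour_sq] at hle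
    have c3 := card_fareyBlock_le (hQ j)
    rw [cast_pow_sixtyFour_sq] at c3
    calc _ ≤ _ := c1
      _ ≤ _ := Finset.sum_le_sum c2
      _ = ((fareyBlock (64 ^ j)).card : ℝ) * (2 * (2 * approxRadius j) * 4096 ^ m + 2) := by
        rw [Finset.sum_const, nsmul_eq_mul]
      _ ≤ 3 * 4096 ^ j * (2 * (2 * approxRadius j) * 4096 ^ m + 2) := by gcongr
      _ = 12 * 4096 ^ m * (approxRadius j * 4096 ^ j) + 6 * 4096 ^ j := by ring
      _ = _ := by rw [approxRadius_mul_pow]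
  have hcard : ((fareyBlock (64 ^ m)).card : ℝ) ≤ (freshFractions i m).card +
      (12 * 4096 ^ m * harmonicBlock i m + 6 * ∑ j ∈ Finset.Ico i m, (4096 : ℝ) ^ j) := by
    calc ((fareyBlock (64 ^ m)).card : ℝ)
        ≤ (freshFractions i m).card + (∑ j ∈ Finset.Ico i m, ((fareyBlock (64 ^ j)).biUnion
          (fun r' => (fareyBlock (64 ^ m)).filter
            (fun r : ℚ => |(r : ℝ) - r'| ≤ 2 * approxRadius j))).card : ℕ) := by
          exact_mod_cast (Finset.card_le_card hsub).trans ((Finset.card_union_le _ _).trans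
            (Nat.add_le_add_left Finset.card_biUnion_le _))
      _ ≤ _ := by
        push_cast
        gcongr
        refine (Finset.sum_le_sum hbad).trans (le_of_eq ?_)
        rw [Finset.sum_add_distrib, ← Finset.mul_sum, ← Finset.mul_sum, ← Finset.mul_sum,
          harmonicBlock]
  have hlow := sq_le_card_fareyBlock (hQ m)
  rw [cast_pow_sixtyFour_sq] at hlow
  have hgeom := sum_Ico_pow_le i m
  have hp : (0 : ℝ) < 4096 ^ m := by positivity
  have hh : (4096 : ℝ) ^ m * harmonicBlock i m ≤ 4096 ^ m * (1 / 1000) := by gcongr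
  linarith

lemma harmonicBlock_succ {i m : ℕ} (h : i ≤ m) :
    harmonicBlock i (m + 1) = harmonicBlock i m + 1 / 57344 * (1 / ((m : ℝ) + 1)) := by
  rw [harmonicBlock, harmonicBlock, Finset.sum_Ico_succ_top h, mul_add]

lemma volume_approxUnion_succ_ge {i m : ℕ} (hi : 1 ≤ i) (him : i ≤ m)
    (h : harmonicBlock i m ≤ 1 / 1000) :
    volume.real (approxUnion i m) + 1 / 32 * (1 / 57344 * (1 / ((m : ℝ) + 1))) ≤
      volume.real (approxUnion i (m + 1)) := by
  set W : Set ℝ := ⋃ r ∈ freshFractions i m, Metric.ball (r : ℝ) (approxRadius m) with hW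
  have hrad := approxRadius_pos m
  have hfresh : ∀ r ∈ freshFractions i m, r ∈ fareyBlock (64 ^ m) := fun r hr =>
    (mem_freshFractions.mp hr).1
  have hWsub : W ⊆ approxSet m := Set.iUnion₂_subset fun r hr =>
    Set.subset_biUnion_of_mem (u := fun r : ℚ => Metric.ball (r : ℝ) (approxRadius m))
      (hfresh r hr)
  have hunion : approxUnion i m ∪ W ⊆ approxUnion i (m + 1) := by
    refine Set.union_subset ?_ ?_
    · exact Set.biUnion_subset_biUnion_left
        (Finset.Ico_subset_Ico_right (Nat.le_succ m))
    · exact hWsub.trans (Set.subset_biUnion_of_mem (u := fun j => approxSet j)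
        (Finset.mem_coe.mpr (Finset.mem_Ico.mpr ⟨him, Nat.lt_succ_self m⟩)))
  have hdisj : Disjoint (approxUnion i m) W := by
    simp only [approxUnion, approxSet, hW, Set.disjoint_iUnion_left, Set.disjoint_iUnion_right]
    intro r hr j hj r' hr'
    apply Metric.ball_disjoint_ball
    have h1 := (mem_freshFractions.mp hr).2 j hj r' hr'
    have h2 := approxRadius_anti (Finset.mem_Ico.mp hj).2.le
    rw [dist_comm, Real.dist_eq]
    linarith
  have hWopen : IsOpen W := isOpen_biUnion fun _ _ => Metric.isOpen_ball
  have hWvol : volume.real W = (freshFractions i m).card * (2 * approxRadius m) := by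
    rw [hW, measureReal_biUnion_finset _ (fun _ _ => measurableSet_ball)
      (fun _ _ => measure_ball_lt_top.ne),
      Finset.sum_congr rfl (fun r _ => Real.volume_real_ball hrad.le), Finset.sum_const,
      nsmul_eq_mul]
    intro r hr r' hr' hne
    apply Metric.ball_disjoint_ball
    have h1 := one_div_sq_le_abs_sub (mem_fareyBlock.mp (hfresh r hr)).2.1
      (mem_fareyBlock.mp (hfresh r' hr')).2.1 hne
    rw [cast_pow_sixtyFour_sq] at h1
    have h2 := two_mul_approxRadius_lt m
    rw [Real.dist_eq]
    linarith
  have hWlow : 1 / 32 * (1 / 57344 * (1 / ((m : ℝ) + 1))) ≤ volume.real W := by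
    rw [hWvol, ← approxRadius_mul_pow]
    have := card_freshFractions_ge h
    calc 1 / 32 * (approxRadius m * 4096 ^ m) = 4096 ^ m / 64 * (2 * approxRadius m) := by ring
      _ ≤ _ := by gcongr
  have hadd : volume.real (approxUnion i m ∪ W) = volume.real (approxUnion i m) + volume.real W :=
    measureReal_union hdisj hWopen.measurableSet
      (volume_ne_top_of_subset_Ico (approxUnion_subset_Ico hi))
      (volume_ne_top_of_subset_Ico (hWsub.trans (approxSet_subset_Ico (hi.trans him))))
  have := measureReal_mono hunion (volume_ne_top_of_subset_Ico (approxUnion_subset_Ico hi))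
  linarith

lemma harmonicBlock_le_volume {i : ℕ} (hi : 1 ≤ i) (n : ℕ)
    (h : harmonicBlock i (i + n) ≤ 1 / 1000) :
    1 / 32 * harmonicBlock i (i + n) ≤ volume.real (approxUnion i (i + n)) := by
  induction n with
  | zero => simp [harmonicBlock, approxUnion]
  | succ n ih =>
    rw [← add_assoc] at h ⊢
    have e := harmonicBlock_succ (Nat.le_add_right i n)
    have hpos : (0 : ℝ) < 1 / 57344 * (1 / (((i + n : ℕ) : ℝ) + 1)) := by positivity
    have h' : harmonicBlock i (i + n) ≤ 1 / 1000 := by linarith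
    have := volume_approxUnion_succ_ge hi (Nat.le_add_right i n) h'
    have := ih h'
    rw [e]
    linarith

lemma exists_harmonicBlock_gt (i : ℕ) : ∃ n, 1 / 1000 < harmonicBlock i (i + n) := by
  have h := Real.tendsto_sum_range_one_div_nat_succ_atTop
  obtain ⟨m, him, hm⟩ := ((eventually_ge_atTop i).and (h.eventually_gt_atTop
    (∑ j ∈ Finset.range i, 1 / ((j : ℝ) + 1) + 58))).exists
  refine ⟨m - i, ?_⟩
  rw [Nat.add_sub_cancel' him, harmonicBlock, Finset.sum_Ico_eq_sub _ him]
  linarith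

/-- The approximation sets far out still cover a set of measure bounded below. -/
lemma exists_volume_approxUnion_ge {i : ℕ} (hi : 1 ≤ i) :
    ∃ m, 1 / 64000 ≤ volume.real (approxUnion i m) := by
  have hex := exists_harmonicBlock_gt i
  have hspec := Nat.find_spec hex
  set n := Nat.find hex with hn
  have hn0 : n ≠ 0 := by
    intro h0
    rw [h0] at hspec
    simp [harmonicBlock] at hspec
    linarith
  obtain ⟨k, hk⟩ := Nat.exists_eq_succ_of_ne_zero hn0
  have hkle : harmonicBlock i (i + k) ≤ 1 / 1000 :=
    not_lt.mp (Nat.find_min hex (by rw [← hn, hk]; exact Nat.lt_succ_self k))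
  rw [hk, Nat.succ_eq_add_one, ← add_assoc, harmonicBlock_succ (Nat.le_add_right i k)] at hspec
  refine ⟨i + k, ?_⟩
  have h1 : 1 / (((i + k : ℕ) : ℝ) + 1) ≤ 1 := by
    rw [div_le_one (by positivity)]
    linarith [(Nat.cast_nonneg (i + k) : (0 : ℝ) ≤ ((i + k : ℕ) : ℝ))]
  have := harmonicBlock_le_volume hi k hkle
  linarith

lemma three_le_T_of_mem_approxSet {j : ℕ} {α : ℝ} (h : α ∈ approxSet j) :
    3 ≤ T α (7 * 64 ^ j) 1 := by
  obtain ⟨r, hr, hα⟩ := mem_approxSet.mp h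
  refine three_le_T (r := r) (Nat.mul_le_mul_left 7 (mem_fareyBlock.mp hr).2.1) ?_
  have ha : (a (7 * 64 ^ j) : ℝ) ≤ 8192 * 64 ^ j * (j + 1) := by
    exact_mod_cast a_seven_mul_pow_le j
  calc (a (7 * 64 ^ j) : ℝ) * |α - r| ≤ (8192 * 64 ^ j * (j + 1)) * approxRadius j := by
        gcongr
    _ = 1 / ((7 * 64 ^ j : ℕ) : ℝ) := by
        have : (4096 : ℝ) ^ j = 64 ^ j * 64 ^ j := by rw [← mul_pow]; norm_num
        rw [approxRadius, this]
        push_cast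
        field_simp
        norm_num

/-- The sums of two squares do not have metric Poissonian pair correlation. -/
theorem sum_two_squares_not_MPPC :
    ¬ (∀ᵐ α ∂(volume.restrict (Set.Ico (0:ℝ) 1)),
        ∀ s : ℝ, 0 < s → Tendsto (fun N : ℕ => T α N s) atTop (nhds s)) := by
  intro H
  rw [ae_restrict_iff' measurableSet_Ico] at H
  set E : ℕ → Set ℝ := fun i => ⋃ j ∈ Set.Ici (i + 1), approxSet j with hE
  have hEsub : ∀ i, E i ⊆ Set.Ico 0 1 := fun i => Set.iUnion₂_subset fun j hj =>
    approxSet_subset_Ico ((Nat.succ_le_succ (Nat.zero_le i)).trans hj)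
  have hEopen : ∀ i, IsOpen (E i) := fun i => isOpen_biUnion fun j _ => isOpen_approxSet j
  have hEanti : Antitone E := fun i k hik =>
    Set.biUnion_subset_biUnion_left (Set.Ici_subset_Ici.mpr (Nat.succ_le_succ hik))
  have hElow : ∀ i, ENNReal.ofReal (1 / 64000) ≤ volume (E i) := by
    intro i
    obtain ⟨m, hm⟩ := exists_volume_approxUnion_ge (Nat.succ_le_succ (Nat.zero_le i))
    refine ENNReal.ofReal_le_of_le_toReal (hm.trans ?_)
    refine measureReal_mono ?_ (volume_ne_top_of_subset_Ico (hEsub i))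
    exact Set.biUnion_subset_biUnion_left fun j hj => (Finset.mem_Ico.mp hj).1
  have hnull : volume (⋂ i, E i) = 0 := by
    refine measure_mono_null (fun α hα => ?_) H
    rw [Set.mem_iInter] at hα
    intro hlim
    have hT := hlim (hEsub 0 (hα 0)) 1 one_pos
    obtain ⟨N, hN⟩ := eventually_atTop.mp (hT.eventually_lt_const (by norm_num : (1 : ℝ) < 3))
    obtain ⟨j, hj, hmem⟩ := Set.mem_iUnion₂.mp (hα N)
    have hNj : N ≤ 7 * 64 ^ j := by
      have h1 : N + 1 ≤ j := hj
      have h2 : j < 64 ^ j := Nat.lt_pow_self (by norm_num)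
      omega
    exact absurd (hN _ hNj) (not_lt.mpr (three_le_T_of_mem_approxSet hmem))
  have hlim := tendsto_measure_iInter_atTop (μ := volume)
    (fun i => (hEopen i).measurableSet.nullMeasurableSet) hEanti
    ⟨0, volume_ne_top_of_subset_Ico (hEsub 0)⟩
  rw [hnull] at hlim
  have hle := ge_of_tendsto' hlim hElow
  rw [nonpos_iff_eq_zero, ENNReal.ofReal_eq_zero] at hle
  norm_num at hle
end

section
/- Let B ⊆ ℕ be a set for which there exists a constant c > 0 such that #{n ∈ [M, 2M) : n ∈ B} ≥ c·M/(log log M)² for all sufficiently large M. Fix h < 1. Then for almost every α ∈ [0,1) there exist infinitely many n ∈ B such that ‖nα‖ ≤ 1/(n (log n)^h). -/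
open Real MeasureTheory Filter Finset

/-- Chebyshev's inequality for the event that none of finitely many events occurs, with an
arbitrary centre `S` in place of the mean. -/
lemma sq_mul_measureReal_forall_notMem_le {Ω ι : Type*} [MeasurableSpace Ω] (μ : Measure Ω)
    [IsProbabilityMeasure μ] (P : Finset ι) (I : ι → Set Ω) (hI : ∀ p, MeasurableSet (I p))
    (S : ℝ) :
    S ^ 2 * μ.real {x | ∀ p ∈ P, x ∉ I p} ≤
      ∑ p ∈ P, ∑ q ∈ P, μ.real (I p ∩ I q) - 2 * S * ∑ p ∈ P, μ.real (I p) + S ^ 2 := by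
  classical
  set E : Set Ω := {x | ∀ p ∈ P, x ∉ I p} with hE
  have hEm : MeasurableSet E := by
    have : E = ⋂ p ∈ P, (I p)ᶜ := by ext x; simp [hE]
    rw [this]
    exact Finset.measurableSet_biInter P fun p _ => (hI p).compl
  have hint (s : Set Ω) (hs : MeasurableSet s) : Integrable (s.indicator (1 : Ω → ℝ)) μ :=
    (integrable_const (1 : ℝ)).indicator hs
  have hval (s : Set Ω) (hs : MeasurableSet s) : ∫ x, s.indicator (1 : Ω → ℝ) x ∂μ = μ.real s :=
    integral_indicator_one hs
  let F : Ω → ℝ := fun x =>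
    ∑ p ∈ P, ∑ q ∈ P, (I p ∩ I q).indicator (1 : Ω → ℝ) x
      - 2 * S * ∑ p ∈ P, (I p).indicator (1 : Ω → ℝ) x + S ^ 2
  have hF1 : Integrable (fun x => ∑ p ∈ P, ∑ q ∈ P, (I p ∩ I q).indicator (1 : Ω → ℝ) x) μ :=
    integrable_finsetSum _ fun p _ => integrable_finsetSum _ fun q _ =>
      hint _ ((hI p).inter (hI q))
  have hF2 : Integrable (fun x => 2 * S * ∑ p ∈ P, (I p).indicator (1 : Ω → ℝ) x) μ :=
    (integrable_finsetSum _ fun p _ => hint _ (hI p)).const_mul _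
  have hF : ∫ x, F x ∂μ =
      ∑ p ∈ P, ∑ q ∈ P, μ.real (I p ∩ I q) - 2 * S * ∑ p ∈ P, μ.real (I p) + S ^ 2 := by
    have h1 := integral_add (hF1.sub hF2) (integrable_const (μ := μ) (S ^ 2))
    simp only [Pi.sub_apply] at h1
    rw [h1, integral_sub hF1 hF2,
      integral_const_mul, integral_finsetSum _ fun p _ => hint _ (hI p),
      integral_finsetSum _ fun p _ => integrable_finsetSum _ fun q _ =>
        hint _ ((hI p).inter (hI q))]
    simp only [integral_const, probReal_univ, one_smul]
    congr 2
    · refine Finset.sum_congr rfl fun p _ => ?_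
      rw [integral_finsetSum _ fun q _ => hint _ ((hI p).inter (hI q))]
      exact Finset.sum_congr rfl fun q _ => hval _ ((hI p).inter (hI q))
    · congr 1
      exact Finset.sum_congr rfl fun p _ => hval _ (hI p)
  rw [← hF, ← hval E hEm, ← integral_const_mul]
  refine integral_mono ((hint E hEm).const_mul _) ((hF1.sub hF2).add (integrable_const _))
    fun x => ?_
  have hsq : F x = (∑ p ∈ P, (I p).indicator (1 : Ω → ℝ) x - S) ^ 2 := by
    have : ∑ p ∈ P, ∑ q ∈ P, (I p ∩ I q).indicator (1 : Ω → ℝ) x =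
        (∑ p ∈ P, (I p).indicator (1 : Ω → ℝ) x) ^ 2 := by
      rw [sq, Finset.sum_mul_sum]
      refine Finset.sum_congr rfl fun p _ => Finset.sum_congr rfl fun q _ => ?_
      rw [Set.inter_indicator_one]
      rfl
    simp only [F, this]
    ring
  change S ^ 2 * E.indicator 1 x ≤ F x
  rw [hsq]
  by_cases hx : x ∈ E
  · have : ∑ p ∈ P, (I p).indicator (1 : Ω → ℝ) x = 0 :=
      Finset.sum_eq_zero fun p hp => Set.indicator_of_notMem (hx p hp) _
    simp [hx, this]
  · simp only [hx, not_false_eq_true, Set.indicator_of_notMem, mul_zero]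
    positivity

/-- The length of the intersection of two intervals, as a function of their radii and the
distance between their centres. -/
lemma volume_real_Icc_inter_Icc_le {x y r s : ℝ} (hr : 0 ≤ r) (hs : 0 ≤ s) :
    volume.real (Set.Icc (x - r) (x + r) ∩ Set.Icc (y - s) (y + s)) ≤
      max (r + s - |x - y|) 0 - max (|r - s| - |x - y|) 0 := by
  rw [Set.Icc_inter_Icc, Real.volume_real_Icc]
  rcases abs_cases (x - y) with ⟨h1, _⟩ | ⟨h1, _⟩ <;>
  rcases abs_cases (r - s) with ⟨h2, _⟩ | ⟨h2, _⟩ <;>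
  rw [h1, h2] <;> grind

/-- A Riemann sum of a trapezoidal function is at most its integral. -/
lemma sum_trapezoid_le {A B θ : ℝ} (hB : 0 ≤ B) (hBA : B ≤ A) (hθ : 0 < θ) (L : ℕ) :
    ∑ k ∈ Finset.Icc 1 L, (max (A - k * θ) 0 - max (B - k * θ) 0) ≤
      (A ^ 2 - B ^ 2) / (2 * θ) := by
  have key (k : ℕ) : ∑ k ∈ Finset.Icc 1 k, (max (A - k * θ) 0 - max (B - k * θ) 0) ≤
      (A ^ 2 - B ^ 2) / (2 * θ) -
        ((max (A - k * θ) 0) ^ 2 - (max (B - k * θ) 0) ^ 2) / (2 * θ) := by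
    induction k with
    | zero => simp [hB, hB.trans hBA]
    | succ k ih =>
      rw [Finset.sum_Icc_succ_top (by omega)]
      have step : (max (A - (k + 1 : ℕ) * θ) 0 - max (B - (k + 1 : ℕ) * θ) 0) ≤
          ((max (A - k * θ) 0) ^ 2 - (max (B - k * θ) 0) ^ 2) / (2 * θ) -
          ((max (A - (k + 1 : ℕ) * θ) 0) ^ 2 - (max (B - (k + 1 : ℕ) * θ) 0) ^ 2) / (2 * θ) := by
        rw [← sub_div, le_div_iff₀ (by positivity)]
        push_cast
        have e (C : ℝ) : C - (k + 1) * θ = (C - k * θ) - θ := by ring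
        rw [e, e]
        have hab : B - k * θ ≤ A - k * θ := by linarith
        generalize A - k * θ = a at *
        generalize B - k * θ = b at *
        rcases max_cases (a - θ) 0 with ⟨h1, _⟩ | ⟨h1, _⟩ <;>
        rcases max_cases (b - θ) 0 with ⟨h2, _⟩ | ⟨h2, _⟩ <;>
        rcases max_cases a 0 with ⟨h3, _⟩ | ⟨h3, _⟩ <;>
        rcases max_cases b 0 with ⟨h4, _⟩ | ⟨h4, _⟩ <;>
        rw [h1, h2, h3, h4] <;> nlinarith
      linarith
  refine (key L).trans (sub_le_self _ (div_nonneg (sub_nonneg.2 ?_) (by positivity)))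
  gcongr

lemma sum_le_sum_of_injOn_comp {ι κ : Type*} {s : Finset ι} {t : Finset κ} {f : ι → ℝ}
    {F : κ → ℝ} (g : ι → κ) (hg : Set.InjOn g s) (hst : ∀ i ∈ s, g i ∈ t)
    (hf : ∀ i ∈ s, f i ≤ F (g i)) (hF : ∀ k ∈ t, 0 ≤ F k) :
    ∑ i ∈ s, f i ≤ ∑ k ∈ t, F k := by
  classical
  calc ∑ i ∈ s, f i ≤ ∑ i ∈ s, F (g i) := Finset.sum_le_sum hf
    _ = ∑ k ∈ s.image g, F k := (Finset.sum_image hg).symm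
    _ ≤ ∑ k ∈ t, F k := Finset.sum_le_sum_of_subset_of_nonneg
        (Finset.image_subset_iff.2 hst) fun k hk _ => hF k hk

/-- The length of the intersection of two intervals of radii `r` and `s` whose centres are at
distance `t`. -/
noncomputable def trapezoid (r s t : ℝ) : ℝ := max (r + s - t) 0 - max (|r - s| - t) 0

lemma trapezoid_nonneg {r s : ℝ} (hr : 0 ≤ r) (hs : 0 ≤ s) (t : ℝ) : 0 ≤ trapezoid r s t := by
  have : |r - s| ≤ r + s := abs_le.2 ⟨by linarith, by linarith⟩
  exact sub_nonneg.2 (max_le_max_right _ (by linarith))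

lemma trapezoid_zero_le {r s : ℝ} (hr : 0 ≤ r) (hs : 0 ≤ s) : trapezoid r s 0 ≤ 2 * r := by
  unfold trapezoid
  rcases abs_cases (r - s) with ⟨h2, _⟩ | ⟨h2, _⟩ <;> rw [h2] <;> grind

/-- The total overlap of the intervals of radius `r` about the fractions `a / n` with the intervals
of radius `s` about the fractions `b / m`, leaving out the pairs of equal fractions. -/
lemma sum_trapezoid_fractions_le {n m : ℕ} (hn : 0 < n) (hm : 0 < m) {r s : ℝ} (hr : 0 ≤ r)
    (hs : 0 ≤ s) :
    ∑ p ∈ (range n ×ˢ range m) with p.1 * m ≠ p.2 * n,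
      trapezoid r s |(p.1 : ℝ) / n - (p.2 : ℝ) / m| ≤ 4 * (r * s) * (n * m) := by
  obtain ⟨n', m', hcop, hn', hm'⟩ := Nat.exists_coprime n m
  have hd : 0 < Nat.gcd n m := Nat.gcd_pos_of_pos_left _ hn
  set d := Nat.gcd n m
  have hn0 : 0 < n' := Nat.pos_of_ne_zero fun h => by simp [h] at hn'; omega
  have hm0 : 0 < m' := Nat.pos_of_ne_zero fun h => by simp [h] at hm'; omega
  set θ : ℝ := 1 / (n' * m' * d) with hθ
  have hθ0 : 0 < θ := by positivity
  have hnr : (n : ℝ) = n' * d := by exact_mod_cast hn'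
  have hmr : (m : ℝ) = m' * d := by exact_mod_cast hm'
  have hdist (a b : ℕ) :
      |(a : ℝ) / n - (b : ℝ) / m| = ((a * m' - b * n' : ℤ).natAbs : ℝ) * θ := by
    have : (a : ℝ) / n - (b : ℝ) / m = (a * m' - b * n' : ℤ) * θ := by
      rw [hnr, hmr, hθ]
      push_cast
      field_simp
    rw [this, abs_mul, abs_of_pos hθ0, Nat.cast_natAbs, Int.cast_abs]
  have hdvd : n' ∣ n := ⟨d, hn'⟩
  have hdvd' : m' ∣ m := ⟨d, hm'⟩
  calc _ ≤ ∑ k ∈ Finset.Icc 1 (n * m) ×ˢ ((univ : Finset Bool) ×ˢ range d),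
        trapezoid r s (k.1 * θ) := by
        refine sum_le_sum_of_injOn_comp
          (fun p => ((p.1 * m' - p.2 * n' : ℤ).natAbs, decide (p.2 * n' < p.1 * m'), p.1 / n'))
          ?_ ?_ ?_ fun k _ => trapezoid_nonneg hr hs _
        · rintro ⟨a, b⟩ - ⟨a', b'⟩ - h
          simp only [Prod.mk.injEq, decide_eq_decide] at h
          obtain ⟨h1, h2, h3⟩ := h
          have h4 : (a * m' - b * n' : ℤ) = a' * m' - b' * n' := by
            zify at h2
            omega
          have h5 : (n' : ℤ) ∣ (a - a') * m' := ⟨b - b', by linarith⟩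
          have h6 : (n' : ℤ) ∣ a - a' :=
            IsCoprime.dvd_of_dvd_mul_right (Nat.isCoprime_iff_coprime.2 hcop) h5
          have h7 : a' % n' = a % n' := (Nat.modEq_iff_dvd).2 h6
          have h8 : a = a' := by
            rw [← Nat.div_add_mod a n', ← Nat.div_add_mod a' n', h3, h7]
          subst h8
          have h9 : (b : ℤ) * n' = b' * n' := by linarith
          have h10 : b = b' := by
            have := mul_right_cancel₀ (by positivity) h9
            exact_mod_cast this
          rw [h10]
        · rintro ⟨a, b⟩ hp
          simp only [mem_filter, mem_product, Finset.mem_range] at hp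
          obtain ⟨⟨ha, hb⟩, hne⟩ := hp
          simp only [mem_product, Finset.mem_Icc, Finset.mem_univ, true_and, Finset.mem_range]
          refine ⟨⟨?_, ?_⟩, ?_⟩
          · have : (a * m' : ℕ) ≠ b * n' := fun h => hne <| by
              rw [hm', hn', ← mul_assoc, ← mul_assoc, h]
            zify at this
            omega
          · have h1 : a * m' ≤ n * m := Nat.mul_le_mul ha.le (Nat.le_of_dvd hm hdvd')
            have h2 : b * n' ≤ n * m := by
              rw [mul_comm]
              exact Nat.mul_le_mul (Nat.le_of_dvd hn hdvd) hb.le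
            zify at h1 h2
            have h3 : (0 : ℤ) ≤ a * m' := by positivity
            have h4 : (0 : ℤ) ≤ b * n' := by positivity
            zify
            exact abs_le.2 ⟨by linarith, by linarith⟩
          · exact Nat.div_lt_of_lt_mul (by rwa [← hn'])
        · rintro ⟨a, b⟩ -
          rw [hdist]
    _ = 2 * d * ∑ k ∈ Finset.Icc 1 (n * m), trapezoid r s (k * θ) := by
        rw [Finset.sum_product]
        simp only [Finset.sum_const, card_product, card_univ, Fintype.card_bool, card_range,
          nsmul_eq_mul]
        rw [← Finset.mul_sum]
        push_cast
        rfl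
    _ ≤ 2 * d * (((r + s) ^ 2 - |r - s| ^ 2) / (2 * θ)) := by
        gcongr
        exact sum_trapezoid_le (abs_nonneg _) (abs_le.2 ⟨by linarith, by linarith⟩) hθ0 _
    _ = 4 * (r * s) * (n * m) := by
        rw [sq_abs, hnr, hmr, hθ]
        field_simp
        ring

/-- At most `G` fractions `b / m` with `gcd b m ≤ G` represent a given rational number. -/
lemma card_equal_fractions_le {n a G : ℕ} (hn : 0 < n) (P : Finset (Σ _ : ℕ, ℕ))
    (hP : ∀ q ∈ P, 0 < q.1 ∧ Nat.gcd q.2 q.1 ≤ G ∧ a * q.1 = q.2 * n) : #P ≤ G := by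
  have hpos (q) (hq : q ∈ P) : 0 < Nat.gcd q.2 q.1 := Nat.gcd_pos_of_pos_right _ (hP q hq).1
  have hmul (q) (hq : q ∈ P) : n * Nat.gcd q.2 q.1 = q.1 * Nat.gcd a n := by
    rw [← Nat.gcd_mul_left, ← Nat.gcd_mul_left, mul_comm n q.2, ← (hP q hq).2.2, mul_comm a,
      mul_comm n]
  have := Finset.card_le_card_of_injOn (s := P) (t := Finset.Icc 1 G)
    (fun q => Nat.gcd q.2 q.1) (fun q hq => by
      simpa using ⟨hpos q hq, (hP q hq).2.1⟩) ?_
  · simpa using this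
  · rintro ⟨m, b⟩ hq ⟨m', b'⟩ hq' h
    have h1 := hmul _ hq
    have h2 := hmul _ hq'
    simp only at h h1 h2
    have h3 : m = m' := by
      refine Nat.eq_of_mul_eq_mul_right (Nat.gcd_pos_of_pos_right a hn) ?_
      rw [← h1, ← h2, h]
    subst h3
    have h4 := (hP _ hq).2.2
    have h5 := (hP _ hq').2.2
    simp only at h4 h5
    rw [Nat.eq_of_mul_eq_mul_right hn (h4.symm.trans h5)]

lemma sum_Ico_inv_le (N : ℕ) : ∑ j ∈ Finset.Ico 1 N, (1 : ℝ) / j ≤ 1 + Real.log N := by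
  have h := harmonic_le_one_add_log N
  rw [harmonic_eq_sum_Icc] at h
  push_cast at h
  refine le_trans ?_ h
  simp only [one_div]
  exact Finset.sum_le_sum_of_subset_of_nonneg
    (fun j hj => by simp at hj ⊢; omega) fun _ _ _ => by positivity

/-- On average over `n`, few fractions `a / n` have `gcd a n > G`. -/
lemma sum_card_large_gcd_le {N G : ℕ} {s : Finset ℕ} (hs : s ⊆ Finset.Ico 1 N) :
    ∑ n ∈ s, (#{a ∈ range n | G < Nat.gcd a n} : ℝ) / n ^ 2 ≤
      2 / (G + 1) * (1 + Real.log N) := by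
  calc _ = ∑ p ∈ s.sigma fun n => {a ∈ range n | G < Nat.gcd a n}, (1 : ℝ) / p.1 ^ 2 := by
        rw [Finset.sum_sigma]
        simp [div_eq_mul_inv]
    _ ≤ ∑ q ∈ Finset.Ioo G N ×ˢ (Finset.Ico 1 N).sigma (fun j => range j),
          (1 : ℝ) / (q.1 * q.2.1) ^ 2 := by
        refine sum_le_sum_of_injOn_comp
          (fun p => (Nat.gcd p.2 p.1, ⟨p.1 / Nat.gcd p.2 p.1, p.2 / Nat.gcd p.2 p.1⟩))
          ?_ ?_ ?_ fun _ _ => by positivity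
        · rintro ⟨n, a⟩ - ⟨n', a'⟩ - h
          simp only [Prod.mk.injEq, Sigma.mk.injEq, heq_eq_eq] at h
          obtain ⟨h1, h2, h3⟩ := h
          have e1 : n = n' := by
            rw [← Nat.div_mul_cancel (Nat.gcd_dvd_right a n), h2, h1,
              Nat.div_mul_cancel (Nat.gcd_dvd_right a' n')]
          have e2 : a = a' := by
            rw [← Nat.div_mul_cancel (Nat.gcd_dvd_left a n), h3, h1,
              Nat.div_mul_cancel (Nat.gcd_dvd_left a' n')]
          rw [e1, e2]
        · rintro ⟨n, a⟩ hp
          simp only [Finset.mem_sigma, mem_filter, Finset.mem_range] at hp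
          obtain ⟨hns, han, hG⟩ := hp
          have hn := Finset.mem_Ico.1 (hs hns)
          have hg : 0 < Nat.gcd a n := by omega
          have hga : Nat.gcd a n ≤ n := Nat.le_of_dvd (by omega) (Nat.gcd_dvd_right a n)
          simp only [mem_product, Finset.mem_sigma, Finset.mem_Ioo, Finset.mem_Ico,
            Finset.mem_range]
          refine ⟨⟨hG, by omega⟩, ⟨Nat.div_pos (by omega) hg,
            (Nat.div_le_self _ _).trans_lt hn.2⟩, ?_⟩
          exact Nat.div_lt_div_of_lt_of_dvd (Nat.gcd_dvd_right a n) han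
        · rintro ⟨n, a⟩ -
          have : (n : ℝ) = Nat.gcd a n * (n / Nat.gcd a n : ℕ) := by
            exact_mod_cast (Nat.mul_div_cancel' (Nat.gcd_dvd_right a n)).symm
          simp only
          rw [← this]
    _ = (∑ g ∈ Finset.Ioo G N, ((g : ℝ) ^ 2)⁻¹) * ∑ j ∈ Finset.Ico 1 N, (1 : ℝ) / j := by
        rw [Finset.sum_product, Finset.sum_mul_sum]
        refine Finset.sum_congr rfl fun g _ => ?_
        rw [Finset.sum_sigma]
        refine Finset.sum_congr rfl fun j hj => ?_
        have : (j : ℝ) ≠ 0 := by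
          have := (Finset.mem_Ico.1 hj).1
          positivity
        simp only [Finset.sum_const, card_range, nsmul_eq_mul]
        field_simp
    _ ≤ _ := by
        gcongr
        · exact sum_Ioo_inv_sq_le G N
        · exact sum_Ico_inv_le N

/-- The interval of radius `η / n ^ 2` about the fraction `a / n`, for `p = ⟨n, a⟩`. -/
def fractionInterval (η : ℝ) (p : Σ _ : ℕ, ℕ) : Set ℝ :=
  Set.Icc ((p.2 : ℝ) / p.1 - η / (p.1 : ℝ) ^ 2) ((p.2 : ℝ) / p.1 + η / (p.1 : ℝ) ^ 2)

lemma measurableSet_fractionInterval (η : ℝ) (p : Σ _ : ℕ, ℕ) :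
    MeasurableSet (fractionInterval η p) := measurableSet_Icc

/-- The fractions `a / n` in `[0, 1)` with `n ∈ s` and `gcd a n ≤ G`, as pairs `⟨n, a⟩`. -/
def almostReduced (s : Finset ℕ) (G : ℕ) : Finset (Σ _ : ℕ, ℕ) :=
  s.sigma fun n => {a ∈ range n | Nat.gcd a n ≤ G}

/-- The second moment of the number of almost reduced fractions close to a given point. -/
lemma sum_trapezoid_almostReduced_le {s : Finset ℕ} {G : ℕ} {η : ℝ} (hη : 0 ≤ η)
    (hs : ∀ n ∈ s, 0 < n) :
    ∑ p ∈ almostReduced s G, ∑ q ∈ almostReduced s G,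
      trapezoid (η / (p.1 : ℝ) ^ 2) (η / (q.1 : ℝ) ^ 2) |(p.2 : ℝ) / p.1 - (q.2 : ℝ) / q.1| ≤
      G * (∑ n ∈ s, 2 * η / n) + (∑ n ∈ s, 2 * η / n) ^ 2 := by
  have hr (n : ℕ) : 0 ≤ η / (n : ℝ) ^ 2 := by positivity
  set T : (Σ _ : ℕ, ℕ) → (Σ _ : ℕ, ℕ) → ℝ := fun p q =>
    trapezoid (η / (p.1 : ℝ) ^ 2) (η / (q.1 : ℝ) ^ 2) |(p.2 : ℝ) / p.1 - (q.2 : ℝ) / q.1| with hT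
  have hT0 (p q) : 0 ≤ T p q := trapezoid_nonneg (hr _) (hr _) _
  have hdiag : ∑ p ∈ almostReduced s G,
      ∑ q ∈ almostReduced s G with p.2 * q.1 = q.2 * p.1, T p q ≤
      G * (∑ n ∈ s, 2 * η / n) := by
    calc _ ≤ ∑ p ∈ almostReduced s G, G * (2 * (η / (p.1 : ℝ) ^ 2)) := by
          refine Finset.sum_le_sum fun p hp => ?_
          have hp1 : 0 < p.1 := hs _ (Finset.mem_sigma.1 hp).1
          have hcard : #{q ∈ almostReduced s G | p.2 * q.1 = q.2 * p.1} ≤ G := by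
            refine card_equal_fractions_le (a := p.2) hp1 _ fun q hq => ?_
            simp only [almostReduced, mem_filter, Finset.mem_sigma] at hq
            exact ⟨hs _ hq.1.1, hq.1.2.2, hq.2⟩
          calc _ ≤ ∑ q ∈ almostReduced s G with p.2 * q.1 = q.2 * p.1,
                2 * (η / (p.1 : ℝ) ^ 2) := by
                refine Finset.sum_le_sum fun q hq => ?_
                simp only [almostReduced, mem_filter, Finset.mem_sigma] at hq
                have hq1 : 0 < q.1 := hs _ hq.1.1
                have h0 : (p.2 : ℝ) / p.1 - (q.2 : ℝ) / q.1 = 0 := by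
                  rw [sub_eq_zero, div_eq_div_iff (by positivity) (by positivity)]
                  exact_mod_cast hq.2
                simp only [hT, h0, abs_zero]
                exact trapezoid_zero_le (hr _) (hr _)
            _ ≤ _ := by
                rw [Finset.sum_const, nsmul_eq_mul]
                gcongr
      _ ≤ _ := by
          rw [almostReduced, Finset.sum_sigma, Finset.mul_sum]
          refine Finset.sum_le_sum fun n hn => ?_
          have hn0 : (0 : ℝ) < n := by exact_mod_cast hs n hn
          simp only [Finset.sum_const, nsmul_eq_mul]
          have hc : (#{a ∈ range n | Nat.gcd a n ≤ G} : ℝ) ≤ n := by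
            exact_mod_cast (Finset.card_filter_le _ _).trans (card_range n).le
          calc _ ≤ (n : ℝ) * (G * (2 * (η / (n : ℝ) ^ 2))) := by gcongr
            _ = _ := by field_simp
  have hoff : ∑ p ∈ almostReduced s G,
      ∑ q ∈ almostReduced s G with ¬ p.2 * q.1 = q.2 * p.1, T p q ≤
      (∑ n ∈ s, 2 * η / n) ^ 2 := by
    calc _ = ∑ n ∈ s, ∑ m ∈ s, ∑ a ∈ range n with Nat.gcd a n ≤ G,
          ∑ b ∈ range m with Nat.gcd b m ≤ G,
            if ¬ a * m = b * n then T ⟨n, a⟩ ⟨m, b⟩ else 0 := by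
          simp only [almostReduced, Finset.sum_filter (s := Finset.sigma _ _), Finset.sum_sigma]
          exact Finset.sum_congr rfl fun n _ => Finset.sum_comm
      _ ≤ ∑ n ∈ s, ∑ m ∈ s, ∑ a ∈ range n, ∑ b ∈ range m,
            if ¬ a * m = b * n then T ⟨n, a⟩ ⟨m, b⟩ else 0 := by
          have h0 (n m a b : ℕ) :
              0 ≤ if ¬ a * m = b * n then T ⟨n, a⟩ ⟨m, b⟩ else 0 := by
            split_ifs
            exacts [le_rfl, hT0 _ _]
          refine Finset.sum_le_sum fun n _ => Finset.sum_le_sum fun m _ => ?_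
          refine (Finset.sum_le_sum fun a _ => Finset.sum_le_sum_of_subset_of_nonneg
            (Finset.filter_subset _ _) fun b _ _ => h0 n m a b).trans ?_
          exact Finset.sum_le_sum_of_subset_of_nonneg (Finset.filter_subset _ _)
            fun a _ _ => Finset.sum_nonneg fun b _ => h0 n m a b
      _ ≤ ∑ n ∈ s, ∑ m ∈ s, 4 * (η / (n : ℝ) ^ 2 * (η / (m : ℝ) ^ 2)) * (n * m) := by
          refine Finset.sum_le_sum fun n hn => Finset.sum_le_sum fun m hm => ?_
          refine le_trans (le_of_eq ?_)
            (sum_trapezoid_fractions_le (hs n hn) (hs m hm) (hr n) (hr m))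
          rw [Finset.sum_filter, Finset.sum_product]
      _ = _ := by
          rw [sq, Finset.sum_mul_sum]
          refine Finset.sum_congr rfl fun n hn => Finset.sum_congr rfl fun m hm => ?_
          have hn0 : (0 : ℝ) < n := by exact_mod_cast hs n hn
          have hm0 : (0 : ℝ) < m := by exact_mod_cast hs m hm
          field_simp
          ring
  calc _ = ∑ p ∈ almostReduced s G, (∑ q ∈ almostReduced s G with p.2 * q.1 = q.2 * p.1, T p q +
        ∑ q ∈ almostReduced s G with ¬ p.2 * q.1 = q.2 * p.1, T p q) :=
        Finset.sum_congr rfl fun p _ => (Finset.sum_filter_add_sum_filter_not _ _ _).symm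
    _ ≤ _ := by
        rw [Finset.sum_add_distrib]
        exact add_le_add hdiag hoff

lemma sum_radius_almostReduced_ge {s : Finset ℕ} {N G : ℕ} {η : ℝ} (hη : 0 ≤ η)
    (hs : s ⊆ Finset.Ico 1 N) :
    ∑ n ∈ s, 2 * η / n - 4 * η * (1 + Real.log N) / (G + 1) ≤
      ∑ p ∈ almostReduced s G, 2 * (η / (p.1 : ℝ) ^ 2) := by
  have h : ∑ p ∈ almostReduced s G, 2 * (η / (p.1 : ℝ) ^ 2) = ∑ n ∈ s, 2 * η / n -
      2 * η * ∑ n ∈ s, (#{a ∈ range n | G < Nat.gcd a n} : ℝ) / n ^ 2 := by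
    rw [almostReduced, Finset.sum_sigma, Finset.mul_sum, ← Finset.sum_sub_distrib]
    refine Finset.sum_congr rfl fun n hn => ?_
    have hn0 : (0 : ℝ) < n := by exact_mod_cast (Finset.mem_Ico.1 (hs hn)).1
    have hc := Finset.card_filter_add_card_filter_not (s := range n) (fun a => Nat.gcd a n ≤ G)
    simp only [not_le, card_range] at hc
    have hc' : (#{a ∈ range n | Nat.gcd a n ≤ G} : ℝ) =
        n - #{a ∈ range n | G < Nat.gcd a n} := by
      rw [eq_sub_iff_add_eq]
      exact_mod_cast hc
    simp only [Finset.sum_const, nsmul_eq_mul, hc']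
    field_simp
  have := mul_le_mul_of_nonneg_left (sum_card_large_gcd_le (G := G) hs)
    (show 0 ≤ 2 * η by positivity)
  rw [h]
  calc _ = ∑ n ∈ s, 2 * η / n - 2 * η * (2 / (G + 1) * (1 + Real.log N)) := by ring
    _ ≤ _ := by linarith

/-- The measure of the set of points that are close to no almost reduced fraction with denominator
in `s`. -/
lemma measureReal_forall_notMem_fractionInterval_le {s : Finset ℕ} {N G : ℕ} {η : ℝ}
    (hη : 0 ≤ η) (hη1 : η ≤ 1) (hs : s ⊆ Finset.Ico 2 N) (hsG : ∀ n ∈ s, G < n)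
    (hS : 0 < ∑ n ∈ s, 2 * η / n) :
    (volume.restrict (Set.Ico (0 : ℝ) 1)).real
      {x | ∀ p ∈ almostReduced s G, x ∉ fractionInterval η p} ≤
      (G + 8 * η * (1 + Real.log N) / (G + 1)) / ∑ n ∈ s, 2 * η / n := by
  set μ := volume.restrict (Set.Ico (0 : ℝ) 1) with hμ
  have : IsProbabilityMeasure μ := ⟨by simp [hμ]⟩
  set S := ∑ n ∈ s, 2 * η / n with hSdef
  have hr (n : ℕ) : 0 ≤ η / (n : ℝ) ^ 2 := by positivity
  have hs1 : s ⊆ Finset.Ico 1 N := hs.trans (Finset.Ico_subset_Ico_left (by norm_num))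
  have hpos : ∀ n ∈ s, 0 < n := fun n hn => (Finset.mem_Ico.1 (hs1 hn)).1
  have hcheb := sq_mul_measureReal_forall_notMem_le μ (almostReduced s G) (fractionInterval η)
    (measurableSet_fractionInterval η) S
  have hle (p q) : μ.real (fractionInterval η p ∩ fractionInterval η q) ≤
      trapezoid (η / (p.1 : ℝ) ^ 2) (η / (q.1 : ℝ) ^ 2) |(p.2 : ℝ) / p.1 - (q.2 : ℝ) / q.1| := by
    refine le_trans ?_ (volume_real_Icc_inter_Icc_le (hr _) (hr _))
    refine ENNReal.toReal_mono ?_ (Measure.restrict_apply_le _ _)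
    exact (measure_mono Set.inter_subset_left).trans_lt measure_Icc_lt_top |>.ne
  have hmean (p) (hp : p ∈ almostReduced s G) :
      μ.real (fractionInterval η p) = 2 * (η / (p.1 : ℝ) ^ 2) := by
    obtain ⟨n, a⟩ := p
    simp only [almostReduced, Finset.mem_sigma, mem_filter, Finset.mem_range] at hp
    obtain ⟨hn, han, hg⟩ := hp
    have hn2 : 2 ≤ n := (Finset.mem_Ico.1 (hs hn)).1
    have ha : 1 ≤ a := by
      rcases Nat.eq_zero_or_pos a with rfl | h
      · have := hsG n hn
        simp at hg
        omega
      · exact h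
    have hn2' : (2 : ℝ) ≤ n := by exact_mod_cast hn2
    have ha' : (1 : ℝ) ≤ a := by exact_mod_cast ha
    have han' : (a : ℝ) + 1 ≤ n := by exact_mod_cast han
    have hrad : η / (n : ℝ) ^ 2 < 1 / n := by
      rw [div_lt_div_iff₀ (by positivity) (by positivity)]
      nlinarith
    have hlow : (1 : ℝ) / n ≤ a / n := by gcongr
    have hhigh : (a : ℝ) / n + 1 / n ≤ 1 := by
      rw [← add_div]
      exact div_le_one_of_le₀ han' (by positivity)
    have hsub : fractionInterval η ⟨n, a⟩ ⊆ Set.Ico 0 1 := by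
      rintro x ⟨hx1, hx2⟩
      simp only at hx1 hx2
      exact ⟨by linarith, by linarith⟩
    rw [hμ, measureReal_restrict_apply (measurableSet_fractionInterval η _),
      Set.inter_eq_left.2 hsub, fractionInterval, Real.volume_real_Icc_of_le (by linarith [hr n])]
    ring
  have h2 : ∑ p ∈ almostReduced s G, ∑ q ∈ almostReduced s G,
      μ.real (fractionInterval η p ∩ fractionInterval η q) ≤ G * S + S ^ 2 :=
    (Finset.sum_le_sum fun p _ => Finset.sum_le_sum fun q _ => hle p q).trans
      (sum_trapezoid_almostReduced_le hη hpos)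
  have h1 : S - 4 * η * (1 + Real.log N) / (G + 1) ≤
      ∑ p ∈ almostReduced s G, μ.real (fractionInterval η p) := by
    rw [Finset.sum_congr rfl hmean]
    exact sum_radius_almostReduced_ge hη hs1
  rw [le_div_iff₀ hS]
  refine le_of_mul_le_mul_left ?_ hS
  have h3 := mul_le_mul_of_nonneg_left h1 hS.le
  have h4 : 8 * η * (1 + Real.log N) / (G + 1) = 2 * (4 * η * (1 + Real.log N) / (G + 1)) := by
    ring
  rw [h4]
  nlinarith

open Classical in
/-- The elements of `B` in `[2 ^ K, 4 ^ K)`. -/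
noncomputable def dyadicPart (B : Set ℕ) (K : ℕ) : Finset ℕ :=
  {n ∈ Finset.Ico (2 ^ K) (2 ^ (2 * K)) | n ∈ B}

lemma mem_dyadicPart {B : Set ℕ} {K n : ℕ} :
    n ∈ dyadicPart B K ↔ (2 ^ K ≤ n ∧ n < 2 ^ (2 * K)) ∧ n ∈ B := by
  simp [dyadicPart]

lemma card_block_le_sum_inv (B : Set ℕ) [DecidablePred (· ∈ B)] (k : ℕ) :
    ((Set.Ico (2 ^ k) (2 * 2 ^ k) ∩ B).ncard : ℝ) / (2 * 2 ^ k) ≤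
      ∑ n ∈ Finset.Ico (2 ^ k) (2 ^ (k + 1)) with n ∈ B, (1 : ℝ) / n := by
  have h : (Set.Ico (2 ^ k) (2 * 2 ^ k) ∩ B) =
      (({n ∈ Finset.Ico (2 ^ k) (2 ^ (k + 1)) | n ∈ B} : Finset ℕ) : Set ℕ) := by
    ext n
    simp [pow_succ, mul_comm]
  rw [h, Set.ncard_coe_finset, div_eq_mul_one_div, ← nsmul_eq_mul]
  refine Finset.card_nsmul_le_sum _ _ _ fun n hn => ?_
  obtain ⟨hn, -⟩ := Finset.mem_filter.1 hn
  obtain ⟨hn1, hn2⟩ := Finset.mem_Ico.1 hn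
  have h0 : (0 : ℝ) < n := by exact_mod_cast (Nat.two_pow_pos k).trans_le hn1
  have h1 : (n : ℝ) ≤ 2 * 2 ^ k := by
    rw [pow_succ, mul_comm] at hn2
    exact_mod_cast hn2.le
  gcongr

lemma loglog_two_pow_bounds {k K : ℕ} (hk : 2 ≤ k) (hkK : k ≤ 2 * K) :
    0 < Real.log (Real.log ((2 ^ k : ℕ) : ℝ)) ∧
      Real.log (Real.log ((2 ^ k : ℕ) : ℝ)) ≤ Real.log (2 * K) := by
  have h1 : Real.log ((2 ^ k : ℕ) : ℝ) = k * Real.log 2 := by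
    push_cast
    exact Real.log_pow 2 k
  have hk' : (2 : ℝ) ≤ k := by exact_mod_cast hk
  have hkK' : (k : ℝ) ≤ 2 * K := by exact_mod_cast hkK
  have h2 := Real.log_two_gt_d9
  have h3 := Real.log_two_lt_d9
  rw [h1]
  have h4 : 1 < k * Real.log 2 := by nlinarith
  exact ⟨Real.log_pos h4, Real.log_le_log (by linarith) (by nlinarith)⟩

/-- A set whose dyadic blocks have density at least `c / (log log M) ^ 2` has a large sum of
reciprocals over `[2 ^ K, 4 ^ K)`. -/
lemma sum_inv_dyadicPart_ge {B : Set ℕ} {c : ℝ} (hc : 0 < c) {K : ℕ} (hK : 2 ≤ K)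
    (hB : ∀ k, K ≤ k → c * ((2 ^ k : ℕ) : ℝ) / (Real.log (Real.log ((2 ^ k : ℕ) : ℝ))) ^ 2 ≤
      ((Set.Ico (2 ^ k) (2 * 2 ^ k)) ∩ B).ncard) :
    K * (c / (2 * Real.log (2 * K) ^ 2)) ≤ ∑ n ∈ dyadicPart B K, (1 : ℝ) / n := by
  classical
  have key (L : ℕ) (hL : K ≤ L) : L ≤ 2 * K → ((L : ℝ) - K) * (c / (2 * Real.log (2 * K) ^ 2)) ≤
      ∑ n ∈ Finset.Ico (2 ^ K) (2 ^ L) with n ∈ B, (1 : ℝ) / n := by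
    induction L, hL using Nat.le_induction with
    | base => simp
    | succ k hk ih =>
      intro hkK
      obtain ⟨hl0, hl1⟩ := loglog_two_pow_bounds (hK.trans hk) (show k ≤ 2 * K by omega)
      have hblock : c / (2 * Real.log (2 * K) ^ 2) ≤
          ∑ n ∈ Finset.Ico (2 ^ k) (2 ^ (k + 1)) with n ∈ B, (1 : ℝ) / n := by
        refine le_trans ?_ (card_block_le_sum_inv B k)
        calc c / (2 * Real.log (2 * K) ^ 2)
            ≤ c / (2 * (Real.log (Real.log ((2 ^ k : ℕ) : ℝ))) ^ 2) := by gcongr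
          _ = c * ((2 ^ k : ℕ) : ℝ) / (Real.log (Real.log ((2 ^ k : ℕ) : ℝ))) ^ 2 /
              (2 * 2 ^ k) := by
              push_cast at hl0 ⊢
              field_simp
          _ ≤ _ := by
              gcongr
              exact hB k hk
      have ih' := ih (by omega)
      rw [Finset.sum_filter] at ih' hblock ⊢
      rw [← Finset.sum_Ico_consecutive _ (Nat.pow_le_pow_right two_pos hk)
        (Nat.pow_le_pow_right two_pos k.le_succ)]
      push_cast
      linarith
  have := key (2 * K) (by omega) le_rfl
  push_cast at this
  rw [dyadicPart]
  convert this using 1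
  · ring

lemma nint_le_of_mem_fractionInterval {n a : ℕ} {η x : ℝ} (hn : 0 < n)
    (hx : x ∈ fractionInterval η ⟨n, a⟩) : nint (n * x) ≤ η / n := by
  have hn0 : (0 : ℝ) < n := by exact_mod_cast hn
  have h : |x - a / n| ≤ η / (n : ℝ) ^ 2 := by
    obtain ⟨h1, h2⟩ := hx
    simp only at h1 h2
    exact abs_le.2 ⟨by linarith, by linarith⟩
  calc nint (n * x) ≤ |n * x - (a : ℤ)| := round_le _ _
    _ = n * |x - a / n| := by
        rw [← abs_of_pos hn0, ← abs_mul, abs_of_pos hn0]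
        congr 1
        push_cast
        field_simp
    _ ≤ n * (η / (n : ℝ) ^ 2) := by gcongr
    _ = η / n := by field_simp

/-- The radius `(2K) ^ (-h)` is admissible for every `n` in `[2 ^ K, 4 ^ K)`. -/
lemma div_le_of_mem_dyadicPart {B : Set ℕ} {K n : ℕ} {h h' : ℝ} (hh' : h ≤ h') (h0 : 0 ≤ h')
    (hK : 2 ≤ K) (hn : n ∈ dyadicPart B K) :
    (2 * K : ℝ) ^ (-h') / n ≤ 1 / (n * Real.log n ^ h) := by
  obtain ⟨⟨hn1, hn2⟩, -⟩ := mem_dyadicPart.1 hn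
  have hn4 : 2 ^ 2 ≤ n := (Nat.pow_le_pow_right two_pos hK).trans hn1
  have hn4' : (4 : ℝ) ≤ n := by exact_mod_cast hn4
  have hn2' : (n : ℝ) ≤ 2 ^ (2 * K) := by exact_mod_cast hn2.le
  have hl1 : 1 ≤ Real.log n := by
    rw [Real.le_log_iff_exp_le (by linarith)]
    linarith [Real.exp_one_lt_d9]
  have hl2 : Real.log n ≤ 2 * K := by
    have h1 := Real.log_le_log (by linarith) hn2'
    rw [Real.log_pow] at h1
    push_cast at h1
    have h2 := Real.log_two_lt_d9
    have : (0 : ℝ) ≤ K := by positivity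
    nlinarith
  have h1 : Real.log n ^ h ≤ (2 * K : ℝ) ^ h' :=
    (Real.rpow_le_rpow_of_exponent_le hl1 hh').trans (Real.rpow_le_rpow (by linarith) hl2 h0)
  have hp : 0 < Real.log n ^ h := Real.rpow_pos_of_pos (by linarith) _
  rw [Real.rpow_neg (by positivity), ← one_div, div_div, mul_comm (n : ℝ)]
  gcongr

/-- The points close to no almost reduced fraction with denominator in `dyadicPart B K`, for the
radius `(2K) ^ (-h)` and the bound `(2K) ^ δ` for the greatest common divisors. -/
noncomputable def missedSet (B : Set ℕ) (h δ : ℝ) (K : ℕ) : Set ℝ :=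
  {x | ∀ p ∈ almostReduced (dyadicPart B K) ⌊(2 * K : ℝ) ^ δ⌋₊,
    x ∉ fractionInterval ((2 * K : ℝ) ^ (-h)) p}

lemma measureReal_missedSet_le {B : Set ℕ} {c : ℝ} (hc : 0 < c) {h δ : ℝ} (h0 : 0 ≤ h)
    (hδ0 : 0 < δ) (hδ : h + 2 * δ = 1) {K : ℕ} (hK : 3 ≤ K)
    (hB : ∀ k, K ≤ k → c * ((2 ^ k : ℕ) : ℝ) / (Real.log (Real.log ((2 ^ k : ℕ) : ℝ))) ^ 2 ≤
      ((Set.Ico (2 ^ k) (2 * 2 ^ k)) ∩ B).ncard) :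
    (volume.restrict (Set.Ico (0 : ℝ) 1)).real (missedSet B h δ K) ≤
      34 / c * (Real.log (2 * K : ℕ) ^ (2 : ℝ) / ((2 * K : ℕ) : ℝ) ^ δ) := by
  push_cast
  have hK' : (3 : ℝ) ≤ K := by exact_mod_cast hK
  set X : ℝ := 2 * K with hX
  have hX1 : 1 ≤ X := by linarith
  have hX0 : 0 < X := by linarith
  set η := X ^ (-h) with hη
  set G := ⌊X ^ δ⌋₊ with hG
  set l := Real.log X with hl
  have hl0 : 0 < l := Real.log_pos (by linarith)
  have hη0 : 0 < η := Real.rpow_pos_of_pos hX0 _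
  have hη1 : η ≤ 1 := Real.rpow_le_one_of_one_le_of_nonpos hX1 (by linarith)
  have hXδ : 0 < X ^ δ := Real.rpow_pos_of_pos hX0 _
  have hGX : (G : ℝ) ≤ X ^ δ := Nat.floor_le hXδ.le
  have hXG : X ^ δ ≤ G + 1 := (Nat.lt_floor_add_one _).le
  have hsum := sum_inv_dyadicPart_ge hc (by omega : 2 ≤ K) hB
  rw [← hX, ← hl] at hsum
  have hS : η * X * c / (2 * l ^ 2) ≤ ∑ n ∈ dyadicPart B K, 2 * η / n := by
    have : ∑ n ∈ dyadicPart B K, 2 * η / n = 2 * η * ∑ n ∈ dyadicPart B K, (1 : ℝ) / n := by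
      rw [Finset.mul_sum]
      simp [div_eq_mul_inv]
    rw [this]
    calc η * X * c / (2 * l ^ 2) = 2 * η * (K * (c / (2 * l ^ 2))) := by rw [hX]; ring
      _ ≤ _ := by gcongr
  have hsub : dyadicPart B K ⊆ Finset.Ico 2 (2 ^ (2 * K)) := by
    intro n hn
    obtain ⟨⟨hn1, hn2⟩, -⟩ := mem_dyadicPart.1 hn
    exact Finset.mem_Ico.2 ⟨(Nat.le_self_pow (by omega) 2).trans hn1, hn2⟩
  have hGn : ∀ n ∈ dyadicPart B K, G < n := by
    intro n hn
    have hn1 := (mem_dyadicPart.1 hn).1.1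
    have h1 : X ^ δ ≤ X := by
      simpa using Real.rpow_le_rpow_of_exponent_le hX1 (show δ ≤ 1 by linarith)
    have h2 : G ≤ 2 * K := by
      have := hGX.trans h1
      rw [hX] at this
      exact_mod_cast this
    have h3 : 2 * K < 2 ^ K := by
      clear * - hK
      induction K, hK using Nat.le_induction with
      | base => norm_num
      | succ k hk ih => rw [pow_succ]; omega
    omega
  refine (measureReal_forall_notMem_fractionInterval_le hη0.le hη1 hsub hGn
    (lt_of_lt_of_le (by positivity) hS)).trans ?_
  have hlogN : 1 + Real.log ((2 ^ (2 * K) : ℕ) : ℝ) ≤ 2 * X := by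
    push_cast
    rw [Real.log_pow]
    push_cast
    rw [← hX]
    have := Real.log_two_lt_d9
    nlinarith
  have hlogN0 : 0 ≤ 1 + Real.log ((2 ^ (2 * K) : ℕ) : ℝ) :=
    add_nonneg zero_le_one (Real.log_natCast_nonneg _)
  calc _ ≤ (X ^ δ + 8 * η * (2 * X) / X ^ δ) / (η * X * c / (2 * l ^ 2)) := by gcongr
    _ = 2 * l ^ 2 / c * (X ^ δ / (η * X) + 16 / X ^ δ) := by
        field_simp
        ring
    _ = 34 / c * (l ^ (2 : ℝ) / X ^ δ) := by
        have h1 : η * X = X ^ δ * X ^ δ := by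
          rw [hη, ← Real.rpow_add hX0]
          nth_rewrite 2 [← Real.rpow_one X]
          rw [← Real.rpow_add hX0]
          congr 1
          linarith
        rw [h1, Real.rpow_two]
        field_simp
        ring

lemma tendsto_log_rpow_div_rpow {δ : ℝ} (hδ : 0 < δ) (C : ℝ) :
    Tendsto (fun K : ℕ => C * (Real.log (2 * K : ℕ) ^ (2 : ℝ) / ((2 * K : ℕ) : ℝ) ^ δ)) atTop
      (nhds 0) := by
  have h1 := (isLittleO_log_rpow_rpow_atTop 2 hδ).tendsto_div_nhds_zero
  have h2 : Tendsto (fun K : ℕ => ((2 * K : ℕ) : ℝ)) atTop atTop :=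
    tendsto_natCast_atTop_atTop.comp (tendsto_id.const_mul_atTop' two_pos)
  simpa using (h1.comp h2).const_mul C

/-- If `B ⊆ ℕ` satisfies `#{n ∈ [M,2M) : n ∈ B} ≥ c·M/(log log M)²` for some `c > 0`
and all sufficiently large `M`, then for any fixed `h < 1`, for almost every
`α ∈ [0,1)` there are infinitely many `n ∈ B` with `‖nα‖ ≤ 1/(n (log n)^h)`. -/
theorem lemma1 (B : Set ℕ) (c : ℝ) (hc : 0 < c)
    (hB : ∀ᶠ M : ℕ in atTop,
      c * M / (Real.log (Real.log M)) ^ 2 ≤ ((Set.Ico M (2 * M)) ∩ B).ncard)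
    (h : ℝ) (hh : h < 1) :
    ∀ᵐ α ∂(volume.restrict (Set.Ico (0:ℝ) 1)),
      {n : ℕ | n ∈ B ∧ nint (n * α) ≤ 1 / (n * Real.log n ^ h)}.Infinite := by
  set h' := max h 0 with hh'
  have hh0 : 0 ≤ h' := le_max_right _ _
  have hh1 : h' < 1 := max_lt hh one_pos
  set δ := (1 - h') / 2 with hδ
  have hδ0 : 0 < δ := by linarith
  set μ := volume.restrict (Set.Ico (0 : ℝ) 1) with hμ
  have : IsProbabilityMeasure μ := ⟨by simp [hμ]⟩
  obtain ⟨M₀, hM₀⟩ := eventually_atTop.1 hB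
  have hblock (k : ℕ) (hk : M₀ ≤ k) :
      c * ((2 ^ k : ℕ) : ℝ) / (Real.log (Real.log ((2 ^ k : ℕ) : ℝ))) ^ 2 ≤
        ((Set.Ico (2 ^ k) (2 * 2 ^ k)) ∩ B).ncard :=
    hM₀ (2 ^ k) (hk.trans Nat.lt_two_pow_self.le)
  have hnull (N : ℕ) : μ (⋂ K ≥ N, missedSet B h' δ K) = 0 := by
    rw [← measureReal_eq_zero_iff]
    refine le_antisymm (ge_of_tendsto (tendsto_log_rpow_div_rpow hδ0 (34 / c)) ?_)
      measureReal_nonneg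
    filter_upwards [eventually_ge_atTop N, eventually_ge_atTop 3, eventually_ge_atTop M₀]
      with K hKN hK3 hKM
    refine (measureReal_mono (Set.biInter_subset_of_mem hKN)).trans
      (measureReal_missedSet_le hc hh0 hδ0 (by linarith) hK3 fun k hk => hblock k (hKM.trans hk))
  refine measure_mono_null ?_ (measure_iUnion_null hnull)
  intro x hx
  obtain ⟨N, hN⟩ := (Set.not_infinite.1 hx).bddAbove
  refine Set.mem_iUnion.2 ⟨max N 2, Set.mem_iInter₂.2 fun K hK => ?_⟩
  rintro ⟨n, a⟩ hp hmem
  have hn := (Finset.mem_sigma.1 hp).1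
  obtain ⟨⟨hnK, -⟩, hnB⟩ := mem_dyadicPart.1 hn
  have hn1 : K < n := Nat.lt_two_pow_self.trans_le hnK
  have hle : n ≤ N := hN ⟨hnB, (nint_le_of_mem_fractionInterval (by omega) hmem).trans
    (div_le_of_mem_dyadicPart (le_max_left _ _) hh0 (le_of_max_le_right hK) hn)⟩
  have := le_of_max_le_left hK
  omega
end
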